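/- arXiv:1904.10686 — 2 statements merged into one kernel-verified Lean document; each statement's English description precedes it below -/
import Mathlib

section
/- Under the standing hypotheses, the set H = {g ∈ G : x·l = l·x for every x ∈ D_g and every l ∈ L} is an abelian normal subgroup of G. -/
variable {G : Type*} [Group G] [DecidableEq G] {D : Type*} [DivisionRing D]

/-- A faithful `G`-grading on `D`: a family of additive subgroups forming an internal
direct sum decomposition, multiplicative, with all components nonzero. -/
structure IsFaithfulGrading (𝒜 : G → AddSubgroup D) : Prop where
  one_mem : (1 : D) ∈ 𝒜 1
  mul_mem : ∀ {g h : G} {x y : D}, x ∈ 𝒜 g → y ∈ 𝒜 h → x * y ∈ 𝒜 (g * h)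
  isInternal : DirectSum.IsInternal 𝒜
  faithful : ∀ g, 𝒜 g ≠ ⊥

/-- `L`, the center of the identity component `D_e`, as a set. -/
def Lset (𝒜 : G → AddSubgroup D) : Set D := {x | x ∈ 𝒜 1 ∧ ∀ y ∈ 𝒜 1, x * y = y * x}

/-- The kernel of the conjugation action of `G` on `L`, as a set:
`{g ∈ G : x·l = l·x for every x ∈ D_g and every l ∈ L}`. -/
def Hset (𝒜 : G → AddSubgroup D) : Set G := {g | ∀ x ∈ 𝒜 g, ∀ l ∈ Lset 𝒜, x * l = l * x}


namespace HsetAux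

open Finset

/-- `L`-independent elements of the centralizer of `E` are `E`-independent. -/
theorem indep_centralizer {L E R ι : Type*} [Field L] [DivisionRing E] [Algebra L E]
    (hcen : ∀ x : E, (∀ y, x * y = y * x) → ∃ l : L, x = algebraMap L E l)
    [Ring R] (f : E →+* R) (c : ι → R) (hc : ∀ i e, f e * c i = c i * f e)
    (hind : ∀ (s : Finset ι) (l : ι → L), ∑ i ∈ s, f (algebraMap L E (l i)) * c i = 0 →
      ∀ i ∈ s, l i = 0) (n : ℕ) :
    ∀ (s : Finset ι), s.card = n → ∀ (e : ι → E), ∑ i ∈ s, f (e i) * c i = 0 →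
      ∀ i ∈ s, e i = 0 := by
  classical
  induction n with
  | zero =>
    intro s hs e _ i hi
    rw [Finset.card_eq_zero] at hs
    simp [hs] at hi
  | succ n ih =>
    intro s hs e he i₀ hi₀
    by_contra hne
    set e' : ι → E := fun i => (e i₀)⁻¹ * e i with he'
    have h1 : ∑ i ∈ s, f (e' i) * c i = 0 := by
      have : ∑ i ∈ s, f (e' i) * c i = f (e i₀)⁻¹ * ∑ i ∈ s, f (e i) * c i := by
        rw [Finset.mul_sum]
        refine Finset.sum_congr rfl fun i _ => ?_
        simp [he', mul_assoc]
      rw [this, he, mul_zero]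
    have h0 : e' i₀ = 1 := by simp [he', hne]
    have hcomm : ∀ i ∈ s, ∀ d, e' i * d = d * e' i := by
      intro i hi d
      by_cases hii : i = i₀
      · rw [hii, h0]; simp
      have h2 : ∑ i ∈ s, f (e' i * d - d * e' i) * c i = 0 := by
        have : ∑ i ∈ s, f (e' i * d - d * e' i) * c i
            = (∑ i ∈ s, f (e' i) * c i) * f d - f d * ∑ i ∈ s, f (e' i) * c i := by
          rw [Finset.mul_sum, Finset.sum_mul, ← Finset.sum_sub_distrib]
          refine Finset.sum_congr rfl fun i _ => ?_
          rw [map_sub, map_mul f (e' i) d, map_mul f d (e' i), sub_mul, mul_assoc (f (e' i)) (f d), hc,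
            ← mul_assoc, mul_assoc (f d)]
        rw [this, h1]; simp
      rw [← Finset.add_sum_erase s _ hi₀, h0] at h2
      simp only [one_mul, mul_one, sub_self, map_zero, zero_mul, zero_add] at h2
      have := ih (s.erase i₀) (by rw [Finset.card_erase_of_mem hi₀, hs]; rfl) _ h2 i
        (Finset.mem_erase.2 ⟨hii, hi⟩)
      exact sub_eq_zero.1 this
    choose! l hl using fun i (hi : i ∈ s) => hcen (e' i) (hcomm i hi)
    have h3 := hind s l (by
      rw [← h1]
      exact Finset.sum_congr rfl fun i hi => by rw [← hl i hi]) i₀ hi₀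
    have h4 := hl i₀ hi₀
    rw [h3, h0, map_zero] at h4
    exact one_ne_zero h4

/-- If `e i` are `L`-independent in `E` and `∑ e i * x * c i = 0` for all `x`, then `c = 0`. -/
theorem indep_two_sided {L E ι : Type*} [Field L] [DivisionRing E] [Algebra L E]
    (hcen : ∀ x : E, (∀ y, x * y = y * x) → ∃ l : L, x = algebraMap L E l)
    (e : ι → E)
    (hind : ∀ (s : Finset ι) (l : ι → L), ∑ i ∈ s, algebraMap L E (l i) * e i = 0 →
      ∀ i ∈ s, l i = 0) (n : ℕ) :
    ∀ (s : Finset ι), s.card = n → ∀ (c : ι → E), (∀ x, ∑ i ∈ s, e i * x * c i = 0) →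
      ∀ i ∈ s, c i = 0 := by
  classical
  induction n with
  | zero =>
    intro s hs e _ i hi
    rw [Finset.card_eq_zero] at hs
    simp [hs] at hi
  | succ n ih =>
    intro s hs c he i₀ hi₀
    by_contra hne
    set c' : ι → E := fun i => c i * (c i₀)⁻¹ with hc'
    have h1 : ∀ x, ∑ i ∈ s, e i * x * c' i = 0 := by
      intro x
      have : ∑ i ∈ s, e i * x * c' i = (∑ i ∈ s, e i * x * c i) * (c i₀)⁻¹ := by
        rw [Finset.sum_mul]
        refine Finset.sum_congr rfl fun i _ => ?_
        simp [hc', mul_assoc]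
      rw [this, he, zero_mul]
    have h0 : c' i₀ = 1 := by simp [hc', hne]
    have hcomm : ∀ i ∈ s, ∀ d, c' i * d = d * c' i := by
      intro i hi d
      by_cases hii : i = i₀
      · rw [hii, h0]; simp
      have h2 : ∀ x, ∑ i ∈ s.erase i₀, e i * x * (c' i * d - d * c' i) = 0 := by
        intro x
        have h2 : ∑ i ∈ s, e i * x * (c' i * d - d * c' i) = 0 := by
          have : ∑ i ∈ s, e i * x * (c' i * d - d * c' i)
              = (∑ i ∈ s, e i * x * c' i) * d - ∑ i ∈ s, e i * (x * d) * c' i := by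
            rw [Finset.sum_mul, ← Finset.sum_sub_distrib]
            refine Finset.sum_congr rfl fun i _ => ?_
            simp only [mul_sub, mul_assoc]
          rw [this, h1, h1]; simp
        rw [← Finset.add_sum_erase s _ hi₀, h0] at h2
        simpa using h2
      have := ih (s.erase i₀) (by rw [Finset.card_erase_of_mem hi₀, hs]; rfl) _ h2 i
        (Finset.mem_erase.2 ⟨hii, hi⟩)
      exact sub_eq_zero.1 this
    choose! l hl using fun i (hi : i ∈ s) => hcen (c' i) (hcomm i hi)
    have h3 := hind s l (by
      rw [← h1 1]
      exact Finset.sum_congr rfl fun i hi => by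
        rw [← hl i hi, mul_one, hcomm i hi]) i₀ hi₀
    have h4 := hl i₀ hi₀
    rw [h3, h0, map_zero] at h4
    exact one_ne_zero h4

/-- Finite-dimensionality of `E` over its center. -/
theorem finite_over_center {L E D : Type*} [Field L] [DivisionRing E] [Algebra L E]
    (hcen : ∀ x : E, (∀ y, x * y = y * x) → ∃ l : L, x = algebraMap L E l)
    [DivisionRing D] (f : E →+* D) [Module.Finite (Subring.center D) D]
    {κ : Type*} [Finite κ] (u : κ → D)
    (hu : ∀ x : D, ∃ a : κ → E, x = ∑ᶠ k, f (a k) * u k) :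
    Module.Finite L E := by
  classical
  have := Fintype.ofFinite κ
  let : Module E D := Module.compHom D f
  let : Module L D := Module.compHom D (f.comp (algebraMap L E))
  have hsE : ∀ (e : E) (x : D), e • x = f e * x := fun _ _ => rfl
  have hsL : ∀ (e : L) (x : D), e • x = f (algebraMap L E e) * x := fun _ _ => rfl
  have hfin : Module.Finite E D := by
    refine Module.Finite.of_surjective (M := κ → E) (Fintype.linearCombination E u) ?_
    intro x
    obtain ⟨a, ha⟩ := hu x
    refine ⟨a, ?_⟩
    rw [ha, finsum_eq_sum_of_fintype]
    rfl
  let C : Submodule L D :=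
    { carrier := {c | ∀ e, f e * c = c * f e}
      add_mem' := by
        intro a b ha hb e
        rw [mul_add, add_mul, ha, hb]
      zero_mem' := by intro e; simp
      smul_mem' := by
        intro l x hx e
        rw [hsL, ← mul_assoc, ← map_mul, ← Algebra.commutes, map_mul, mul_assoc, hx, mul_assoc] }
  let b := Module.Basis.ofVectorSpace L C
  have hli : LinearIndependent E (fun i => (b i : D)) := by
    rw [linearIndependent_iff']
    intro s g hg
    refine indep_centralizer hcen f (fun i => (b i : D)) (fun i => (b i).2) ?_ _ s rfl g hg
    intro t l hl
    have h2 : LinearIndependent L (fun i => (b i : D)) :=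
      b.linearIndependent.map' C.subtype (Submodule.ker_subtype C)
    exact linearIndependent_iff'.1 h2 t l hl
  have hfi := hli.finite
  have hC : Module.Finite L C := Module.Finite.of_basis b
  obtain ⟨S, hS⟩ := (inferInstance : Module.Finite (Subring.center D) D)
  have hD : Module.Finite L D := by
    let φ : (S → C) →ₗ[L] D :=
      { toFun := fun a => ∑ s, (a s : D) * s
        map_add' := by
          intro a b
          simp [add_mul, Finset.sum_add_distrib]
        map_smul' := by
          intro l a
          simp [hsL, mul_assoc, Finset.mul_sum] }
    refine Module.Finite.of_surjective φ ?_
    intro x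
    have hx : x ∈ Submodule.span (Subring.center D) (S : Set D) := by rw [hS]; trivial
    rw [Submodule.mem_span_finset'] at hx
    obtain ⟨a, ha⟩ := hx
    refine ⟨fun s => ⟨(a s : D), fun e => (Subring.mem_center_iff.1 (a s).2 _)⟩, ?_⟩
    rw [← ha]
    rfl
  let ψ : E →ₗ[L] D :=
    { toFun := f
      map_add' := map_add f
      map_smul' := by
        intro l e
        rw [Algebra.smul_def, map_mul]; rfl }
  exact Module.Finite.of_injective ψ f.injective

theorem exists_centralizing {L E D : Type*} [Field L] [DivisionRing E] [Algebra L E]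
    (hcen : ∀ x : E, (∀ y, x * y = y * x) → ∃ l : L, x = algebraMap L E l)
    [Module.Finite L E] [DivisionRing D] (f : E →+* D) (u : D) (hu : u ≠ 0)
    (hl : ∀ l : L, f (algebraMap L E l) * u = u * f (algebraMap L E l))
    (hnorm : ∀ e : E, ∃ e' : E, u * f e = f e' * u) :
    ∃ d : E, d ≠ 0 ∧ ∀ e, f e * (f d * u) = f d * u * f e := by
  classical
  let e := Module.finBasis L E
  have hpos : 0 < Module.finrank L E := Module.finrank_pos
  let τ : E →ₗ[L] L := e.coord ⟨0, hpos⟩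
  have hτ : τ (e ⟨0, hpos⟩) = 1 := by simp [τ]
  let B : LinearMap.BilinForm L E := (LinearMap.mul L E).compr₂ τ
  have hBx : ∀ x y, B x y = τ (x * y) := fun _ _ => rfl
  have hB : B.Nondegenerate := by
    constructor
    · intro x hx
      by_contra hne
      have := hx (x⁻¹ * e ⟨0, hpos⟩)
      rw [hBx, mul_inv_cancel_left₀ hne, hτ] at this
      exact one_ne_zero this
    · intro x hx
      by_contra hne
      have := hx (e ⟨0, hpos⟩ * x⁻¹)
      rw [hBx, inv_mul_cancel_right₀ hne, hτ] at this
      exact one_ne_zero this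
  let b := B.dualBasis hB e
  have hbe : ∀ i j, τ (b i * e j) = if j = i then 1 else 0 := by
    intro i j
    exact LinearMap.BilinForm.apply_dualBasis_left hB e i j
  have hkey : ∀ (d : E) j, b j * d = ∑ i, e.repr (d * e i) j • b i := by
    intro d j
    have h1 : B (b j * d) = B (∑ i, e.repr (d * e i) j • b i) := by
      refine e.ext fun k => ?_
      rw [hBx, hBx, Finset.sum_mul, map_sum]
      simp only [smul_mul_assoc, map_smul, hbe, smul_eq_mul, mul_ite, mul_one, mul_zero]
      rw [Finset.sum_ite_eq, if_pos (Finset.mem_univ k), mul_assoc]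
      conv_lhs => rw [← e.sum_repr (d * e k)]
      rw [Finset.mul_sum, map_sum]
      simp only [mul_smul_comm, map_smul, hbe, smul_eq_mul, mul_ite, mul_one, mul_zero]
      rw [Finset.sum_ite_eq', if_pos (Finset.mem_univ j)]
    have h2 := hB.1 (b j * d - ∑ i, e.repr (d * e i) j • b i) (by
      intro y
      rw [map_sub, h1]; simp)
    exact sub_eq_zero.1 h2
  choose s hs using fun i => hnorm (b i)
  have hb0 : ∃ x, ∑ i, e i * x * s i ≠ 0 := by
    by_contra! hcon
    have := indep_two_sided hcen e (by
      intro t l hl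
      refine linearIndependent_iff'.1 e.linearIndependent t l ?_
      rw [← hl]
      exact Finset.sum_congr rfl fun i _ => Algebra.smul_def _ _) _ Finset.univ rfl s hcon
      ⟨0, hpos⟩ (Finset.mem_univ _)
    have h3 := hs ⟨0, hpos⟩
    rw [this, map_zero, zero_mul, mul_eq_zero, or_iff_right hu, map_eq_zero] at h3
    exact b.ne_zero _ h3
  obtain ⟨x, hx⟩ := hb0
  refine ⟨_, hx, fun a => ?_⟩
  have hv : f (∑ i, e i * x * s i) * u = ∑ i, f (e i) * (f x * u) * f (b i) := by
    rw [map_sum, Finset.sum_mul]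
    refine Finset.sum_congr rfl fun i _ => ?_
    rw [mul_assoc (f (e i)), mul_assoc (f x), hs, map_mul, map_mul]
    simp only [mul_assoc]
  have hy : ∀ l : L, f (algebraMap L E l) * (f x * u) = (f x * u) * f (algebraMap L E l) := by
    intro l
    rw [← mul_assoc, ← map_mul, Algebra.commutes, map_mul, mul_assoc, hl, mul_assoc]
  rw [hv]
  generalize f x * u = y at hy
  have hL : ∀ i, f a * (f (e i) * y * f (b i))
      = ∑ j, f (e j) * y * f (e.repr (a * e i) j • b i) := by
    intro i
    rw [← mul_assoc, ← mul_assoc, ← map_mul]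
    conv_lhs => rw [← e.sum_repr (a * e i)]
    rw [map_sum, Finset.sum_mul, Finset.sum_mul]
    refine Finset.sum_congr rfl fun j _ => ?_
    rw [Algebra.smul_def, Algebra.smul_def, Algebra.commutes, map_mul f, map_mul f, mul_assoc (f (e j)),
      hy]
    simp only [mul_assoc]
  rw [Finset.mul_sum, Finset.sum_mul, Finset.sum_congr rfl fun i _ => hL i, Finset.sum_comm]
  refine Finset.sum_congr rfl fun j _ => ?_
  rw [mul_assoc _ (f (b j)), ← map_mul, hkey, map_sum, Finset.mul_sum]

end HsetAux

namespace HsetAux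

/-- In a division ring, commuting roots of unity are powers of one another. -/
theorem root_eq_pow {D : Type*} [DivisionRing D] {x b : D} (h : x * b = b * x)
    (hb : 0 < orderOf b) (hx : x ^ orderOf b = 1) : ∃ i : ℕ, x = b ^ i := by
  have hcomm : ∀ p ∈ ({x, b} : Set D), ∀ q ∈ ({x, b} : Set D), p * q = q * p := by
    rintro p (rfl | rfl) q (rfl | rfl)
    · rfl
    · exact h
    · exact h.symm
    · rfl
  let : CommRing (Subring.closure ({x, b} : Set D)) :=
    { (inferInstance : Ring (Subring.closure ({x, b} : Set D))) with
      mul_comm := (Subring.isMulCommutative_closure hcomm).is_comm.comm }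
  have hdom : IsDomain (Subring.closure ({x, b} : Set D)) := inferInstance
  let x' : Subring.closure ({x, b} : Set D) := ⟨x, Subring.subset_closure (by simp)⟩
  let b' : Subring.closure ({x, b} : Set D) := ⟨b, Subring.subset_closure (by simp)⟩
  have ho : orderOf b' = orderOf b :=
    (orderOf_injective (Subring.closure ({x, b} : Set D)).subtype.toMonoidHom
      Subtype.val_injective b').symm
  have hp : IsPrimitiveRoot b' (orderOf b) := by
    rw [← ho]; exact IsPrimitiveRoot.orderOf b'
  have hx' : x' ^ orderOf b = 1 := Subtype.ext hx
  have : NeZero (orderOf b) := ⟨hb.ne'⟩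
  obtain ⟨i, -, hi⟩ := hp.eq_pow_of_pow_eq_one hx'
  exact ⟨i, (congrArg Subtype.val hi).symm⟩

structure CoreData {D Γ H : Type*} [DivisionRing D] [Group Γ] [Group H]
    (ι : Γ →* D) (π : Γ →* H) (ζ : D) (n : ℕ) : Prop where
  inj : Function.Injective ι
  surj : Function.Surjective π
  cent : ∀ z, π z = 1 → ∀ g, z * g = g * z
  zcen : ∀ x : D, ζ * x = x * ζ
  npos : 0 < n
  ord : orderOf ζ = n
  exp : ∀ h : H, h ^ n = 1
  root : ∀ γ (i : ℕ), ι γ = ζ ^ i → π γ = 1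

section
variable {D Γ H : Type*} [DivisionRing D] [Group Γ] [Group H]
    {ι : Γ →* D} {π : Γ →* H} {ζ : D} {n : ℕ}

theorem CoreData.tors (h : CoreData ι π ζ n) {t : Γ} (ht : t ^ n = 1) : π t = 1 := by
  obtain ⟨i, hi⟩ := root_eq_pow (x := ι t) (b := ζ) (h.zcen _).symm (by rw [h.ord]; exact h.npos)
    (by rw [h.ord, ← map_pow, ht, map_one])
  exact h.root t i hi

theorem CoreData.tors_dvd (h : CoreData ι π ζ n) {t : Γ} {m : ℕ} (ht : t ^ m = 1) (hm : m ∣ n) :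
    π t = 1 := by
  obtain ⟨k, rfl⟩ := hm
  exact h.tors (by rw [pow_mul, ht, one_pow])

/-- If `a` commutes with its conjugate by `g`, then `g` and `a` commute modulo the kernel. -/
theorem CoreData.kummer (h : CoreData ι π ζ n) {g a c : Γ} (hc : g * a = c * a * g)
    (hca : c * a = a * c) : π c = 1 := by
  apply h.tors
  have h1 : g * a ^ n * g⁻¹ = a ^ n := by
    rw [← h.cent (a ^ n) (by rw [map_pow, h.exp]) g, mul_inv_cancel_right]
  have h2 : g * a * g⁻¹ = c * a := by rw [hc, mul_inv_cancel_right]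
  rw [← conj_pow, h2, (show Commute c a from hca).mul_pow] at h1
  exact mul_eq_right.1 h1

theorem CoreData.classTwo (h : CoreData ι π ζ n) {x y c ξ η : Γ} (hc : x * y = c * y * x)
    (hξ : c * x = ξ * x * c) (hη : c * y = η * y * c) (hξ1 : π ξ = 1) (j : ℕ) (hj : η = ξ ^ j) :
    π c = 1 := by
  have hξc := h.cent ξ hξ1
  have h1 : c * x ^ j = ξ ^ j * x ^ j * c := by
    have h2 : c * x * c⁻¹ = ξ * x := by rw [hξ, mul_inv_cancel_right]
    have h3 : (c * x * c⁻¹) ^ j = (ξ * x) ^ j := by rw [h2]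
    rw [conj_pow, (show Commute ξ x from hξc x).mul_pow] at h3
    rw [← h3, inv_mul_cancel_right]
  have hyc : c * (y * (x ^ j)⁻¹) = (y * (x ^ j)⁻¹) * c := by
    have hη1 : ∀ g, η * g = g * η := by
      intro g; rw [hj]; exact ((show Commute ξ g from hξc g).pow_left j)
    rw [← hj] at h1
    have h4 : c * (x ^ j)⁻¹ = η⁻¹ * (x ^ j)⁻¹ * c := by
      have : x ^ j * c = η⁻¹ * c * x ^ j := by
        rw [mul_assoc, h1, mul_assoc, inv_mul_cancel_left]
      have h6 : (x ^ j)⁻¹ * (x ^ j * c) * (x ^ j)⁻¹ = (x ^ j)⁻¹ * (η⁻¹ * c * x ^ j) * (x ^ j)⁻¹ := by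
        rw [this]
      have h7 : ∀ g, η⁻¹ * g = g * η⁻¹ := fun g => (show Commute η g from hη1 g).inv_left
      rw [h7 (x ^ j)⁻¹, mul_assoc]
      rw [mul_assoc (η⁻¹), ← mul_assoc ((x^j)⁻¹)  (η⁻¹) _, ← mul_assoc _ c, mul_assoc _ (x ^ j),
        mul_inv_cancel, mul_one, inv_mul_cancel_left, mul_assoc] at h6
      exact h6
    rw [← mul_assoc, hη, mul_assoc, h4, hη1 y]
    rw [mul_assoc y η, ← mul_assoc η, ← mul_assoc η, mul_inv_cancel, one_mul, mul_assoc]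
  refine h.kummer (g := x) (a := y * (x ^ j)⁻¹) (c := c) ?_ hyc
  rw [← mul_assoc, hc]
  have : x * (x ^ j)⁻¹ = (x ^ j)⁻¹ * x := (Commute.refl x).pow_right j |>.inv_right
  rw [mul_assoc (c * y), this]
  simp only [mul_assoc]

theorem CoreData.pPart (h : CoreData ι π ζ n) {x y c : Γ} {p k : ℕ} (hp : p.Prime)
    (hx : π x ^ p ^ k = 1) (hy : π y ^ p ^ k = 1) (hc : x * y = c * y * x)
    (hcx : π c * π x = π x * π c) (hcy : π c * π y = π y * π c) : π c = 1 := by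
  -- the commutators with `c`
  have key : ∀ g, π c * π g = π g * π c → π g ^ p ^ k = 1 →
      ∃ ξ, π ξ = 1 ∧ c * g = ξ * g * c ∧ ξ ^ p ^ k = 1 := by
    intro g hg hgk
    refine ⟨c * g * c⁻¹ * g⁻¹, ?_, by group, ?_⟩
    · simp only [map_mul, map_inv]; rw [hg]; group
    · set ξ := c * g * c⁻¹ * g⁻¹ with hξd
      have hξ1 : π ξ = 1 := by
        simp only [hξd, map_mul, map_inv]; rw [hg]; group
      have h1 : c * g * c⁻¹ = ξ * g := by rw [hξd]; group
      have h2 : (c * g * c⁻¹) ^ p ^ k = (ξ * g) ^ p ^ k := by rw [h1]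
      rw [conj_pow, (show Commute ξ g from h.cent ξ hξ1 g).mul_pow,
        ← h.cent (g ^ p ^ k) (by rw [map_pow, hgk]) c, mul_inv_cancel_right] at h2
      exact right_eq_mul.1 h2
  obtain ⟨ξ, hξ1, hξ, hξk⟩ := key x hcx hx
  obtain ⟨η, hη1, hη, hηk⟩ := key y hcy hy
  have main : ∀ a b : Γ, π a = 1 → a ^ p ^ k = 1 → b ^ p ^ k = 1 → orderOf a ≤ orderOf b →
      ∃ j : ℕ, a = b ^ j := by
    intro a b ha hak hbk hle
    obtain ⟨i, -, hi⟩ := (Nat.dvd_prime_pow hp).1 (orderOf_dvd_of_pow_eq_one hak)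
    obtain ⟨i', -, hi'⟩ := (Nat.dvd_prime_pow hp).1 (orderOf_dvd_of_pow_eq_one hbk)
    have hii : i ≤ i' := by
      rw [hi, hi'] at hle
      exact (Nat.pow_le_pow_iff_right hp.one_lt).1 hle
    have hob : orderOf (ι b) = orderOf b := orderOf_injective ι h.inj b
    obtain ⟨j, hj⟩ := root_eq_pow (x := ι a) (b := ι b)
      (by rw [← map_mul, ← map_mul, h.cent a ha])
      (by rw [hob, hi']; exact pow_pos hp.pos _)
      (by
        rw [hob, hi', ← map_pow]
        have : a ^ p ^ i' = 1 := by
          apply orderOf_dvd_iff_pow_eq_one.1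
          rw [hi]; exact pow_dvd_pow p hii
        rw [this, map_one])
    exact ⟨j, h.inj (by rw [hj, map_pow])⟩
  rcases le_total (orderOf η) (orderOf ξ) with hle | hle
  · obtain ⟨j, hj⟩ := main η ξ hη1 hηk hξk hle
    exact h.classTwo hc hξ hη hξ1 j hj
  · obtain ⟨j, hj⟩ := main ξ η hξ1 hξk hηk hle
    have hinv : ∀ g θ, π θ = 1 → c * g = θ * g * c → c⁻¹ * g = θ⁻¹ * g * c⁻¹ := by
      intro g θ hθ hg
      have h1 : g * c = θ⁻¹ * c * g := by rw [mul_assoc, hg, mul_assoc, inv_mul_cancel_left]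
      have h2 : θ⁻¹ * c = c * θ⁻¹ := (show Commute θ c from h.cent θ hθ c).inv_left
      rw [h2, mul_assoc] at h1
      rw [eq_mul_inv_iff_mul_eq, mul_assoc, h1, inv_mul_cancel_left]
    have := h.classTwo (x := y) (y := x) (c := c⁻¹) (ξ := η⁻¹) (η := ξ⁻¹)
      (by rw [mul_assoc, hc, mul_assoc, inv_mul_cancel_left])
      (hinv y η hη1 hη) (hinv x ξ hξ1 hξ) (by rw [map_inv, hη1, inv_one]) j (by rw [hj, inv_pow])
    rwa [map_inv, inv_eq_one] at this

/-- `p`-subgroups of `H` are abelian. -/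
theorem CoreData.pGroup_comm [Finite H] (h : CoreData ι π ζ n) {p : ℕ} (hp : p.Prime)
    (P : Subgroup H) (hP : IsPGroup p P) : ∀ a ∈ P, ∀ b ∈ P, a * b = b * a := by
  have : Fact p.Prime := ⟨hp⟩
  by_contra! hcon
  obtain ⟨a, ha, b, hb, hab⟩ := hcon
  have hQ : IsPGroup p (P ⧸ Subgroup.center P) := hP.to_quotient _
  have hnt : Nontrivial (P ⧸ Subgroup.center P) := by
    refine ⟨((⟨a, ha⟩ : P) : P ⧸ Subgroup.center P), 1, fun hc => hab ?_⟩
    rw [QuotientGroup.eq_one_iff, Subgroup.mem_center_iff] at hc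
    exact (congrArg Subtype.val (hc ⟨b, hb⟩)).symm
  have := hQ.center_nontrivial
  obtain ⟨⟨q, hq⟩, hq1⟩ := exists_ne (1 : Subgroup.center (P ⧸ Subgroup.center P))
  obtain ⟨x, rfl⟩ := QuotientGroup.mk_surjective q
  apply hq1
  apply Subtype.ext
  change (x : P ⧸ Subgroup.center P) = 1
  rw [QuotientGroup.eq_one_iff, Subgroup.mem_center_iff]
  intro y
  rw [Subgroup.mem_center_iff] at hq
  have h1 := hq y
  rw [← QuotientGroup.mk_mul, ← QuotientGroup.mk_mul, eq_comm] at h1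
  have h2 : x * y * x⁻¹ * y⁻¹ ∈ Subgroup.center P := by
    rw [← QuotientGroup.eq_one_iff]
    rw [QuotientGroup.mk_mul, QuotientGroup.mk_mul, h1, ← QuotientGroup.mk_mul,
      ← QuotientGroup.mk_mul]
    simp
  rw [Subgroup.mem_center_iff] at h2
  obtain ⟨x', hx'⟩ := h.surj (x : H)
  obtain ⟨y', hy'⟩ := h.surj (y : H)
  obtain ⟨k, hk⟩ := hP x
  obtain ⟨l, hl⟩ := hP y
  have hk' := congrArg Subtype.val hk
  have hl' := congrArg Subtype.val hl
  have e2 := fun g => congrArg Subtype.val (h2 g)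
  simp only [Subgroup.coe_mul, Subgroup.coe_inv, Subgroup.coe_pow, Subgroup.coe_one] at hk' hl' e2
  have := h.pPart (x := x') (y := y') (c := x' * y' * x'⁻¹ * y'⁻¹) (k := k + l) hp
    (by rw [hx', pow_add, pow_mul, hk', one_pow])
    (by rw [hy', add_comm, pow_add, pow_mul, hl', one_pow]) (by group)
    (by simp only [map_mul, map_inv, hx', hy']; exact (e2 x).symm)
    (by simp only [map_mul, map_inv, hx', hy']; exact (e2 y).symm)
  simp only [map_mul, map_inv, hx', hy'] at this
  apply Subtype.ext
  simp only [Subgroup.coe_mul]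
  rw [mul_inv_eq_one, mul_inv_eq_iff_eq_mul] at this
  exact this.symm


theorem commute_of_pow_coprime {y c : H} {m : ℕ} (h : Commute (y ^ m) c)
    (hm : (orderOf y).Coprime m) : Commute y c := by
  obtain ⟨k, hk⟩ := exists_pow_eq_self_of_coprime hm.symm
  rw [← hk]
  exact h.pow_left k

theorem mul_pow_twisted {c x v : Γ} (hv : ∀ g, v * g = g * v) (hxc : x * c = v * c * x) (m : ℕ) :
    x ^ m * c = v ^ m * c * x ^ m ∧ (c * x) ^ m = v ^ (m.choose 2) * c ^ m * x ^ m := by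
  have hvm : ∀ (m : ℕ) g, v ^ m * g = g * v ^ m := fun m g => (show Commute v g from hv g).pow_left m
  have h1 : ∀ m : ℕ, x ^ m * c = v ^ m * c * x ^ m := by
    intro m
    induction m with
    | zero => simp
    | succ m ih =>
      rw [pow_succ x, mul_assoc, hxc, mul_assoc v, ← mul_assoc (x ^ m), ← hv (x ^ m), mul_assoc v,
        ← mul_assoc (x ^ m), ih, pow_succ' v]
      simp only [mul_assoc]
  refine ⟨h1 m, ?_⟩
  induction m with
  | zero => simp
  | succ m ih =>
    rw [pow_succ (c * x), ih, Nat.choose_succ_succ' m 1, Nat.choose_one_right, add_comm m, pow_add v]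
    calc v ^ m.choose 2 * c ^ m * x ^ m * (c * x) = v ^ m.choose 2 * c ^ m * (x ^ m * c) * x := by
          simp only [mul_assoc]
      _ = v ^ m.choose 2 * (c ^ m * v ^ m) * c * x ^ m * x := by rw [h1]; simp only [mul_assoc]
      _ = _ := by rw [← hvm m (c ^ m), pow_succ c, pow_succ x]; simp only [mul_assoc]

theorem CoreData.conj_cases (h : CoreData ι π ζ n) {x y c v : Γ} {p k : ℕ} (hp : p.Prime)
    (hxp : orderOf (π x) = p ^ k) (hc : y * x = c * x * y) (hv : x * c = v * c * x)
    (hv1 : π v = 1) :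
    π c = 1 ∨ (p = 2 ∧ π x ^ 2 = 1 ∧ c ^ 2 = v ∧ v ^ 2 = 1 ∧ v ≠ 1) := by
  have hvc := h.cent v hv1
  have hqn : p ^ k ∣ n := by rw [← hxp]; exact orderOf_dvd_of_pow_eq_one (h.exp _)
  have hxq : π (x ^ p ^ k) = 1 := by rw [map_pow, ← hxp, pow_orderOf_eq_one]
  have hxc := h.cent _ hxq
  have hvq : v ^ p ^ k = 1 := by
    have h1 := (mul_pow_twisted hvc hv (p ^ k)).1
    rw [hxc c, mul_assoc] at h1
    exact right_eq_mul.1 h1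
  have hcq : v ^ ((p ^ k).choose 2) * c ^ p ^ k = 1 := by
    have h1 := (mul_pow_twisted hvc hv (p ^ k)).2
    have h2 : c * x = y * x * y⁻¹ := by rw [hc, mul_inv_cancel_right]
    rw [h2, conj_pow, ← hxc y, mul_inv_cancel_right] at h1
    exact right_eq_mul.1 h1
  rcases hp.eq_two_or_odd' with rfl | hodd
  · rcases k with _ | k
    · left
      simp at hcq
      rw [hcq, map_one]
    have hch : (2 ^ (k + 1)).choose 2 = 2 ^ k * (2 ^ (k + 1) - 1) := by
      rw [Nat.choose_two_right, pow_succ, mul_comm (2 ^ k) 2, mul_assoc, Nat.mul_div_cancel_left _ (by norm_num)]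
    have hcq2 : c ^ 2 ^ (k + 1) = v ^ 2 ^ k := by
      have h3 : v ^ 2 ^ k * v ^ (2 ^ (k + 1)).choose 2 = 1 := by
        rw [hch, ← pow_add]
        have : 2 ^ k + 2 ^ k * (2 ^ (k + 1) - 1) = 2 ^ (k + 1) * 2 ^ k := by
          have : 1 ≤ 2 ^ (k + 1) := Nat.one_le_two_pow
          obtain ⟨r, hr⟩ := Nat.exists_eq_add_of_le this
          rw [hr]; simp; ring
        rw [this, pow_mul, hvq, one_pow]
      calc c ^ 2 ^ (k + 1) = (v ^ 2 ^ k * v ^ (2 ^ (k + 1)).choose 2) * c ^ 2 ^ (k + 1) := by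
            rw [h3, one_mul]
        _ = v ^ 2 ^ k := by rw [mul_assoc, hcq, mul_one]
    by_cases hone : v ^ 2 ^ k = 1
    · left
      rw [hone] at hcq2
      exact h.tors_dvd hcq2 hqn
    rcases k with _ | k
    · right
      simp only [zero_add, pow_one, pow_zero] at *
      refine ⟨trivial, ?_, hcq2, hvq, hone⟩
      rw [← map_pow, hxq]
    · exfalso
      apply hone
      have h4 : (c ^ 2 ^ (k + 1)) ^ 2 ^ 2 = 1 := by
        rw [← pow_mul, ← pow_add, show k + 1 + 2 = (k + 1 + 1) + 1 by ring, pow_succ, pow_mul, hcq2,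
          ← pow_mul, ← pow_succ, hvq]
      have h5 : π (c ^ 2 ^ (k + 1)) = 1 := by
        refine h.tors_dvd h4 (dvd_trans ?_ hqn)
        exact pow_dvd_pow 2 (by omega)
      have h6 := (mul_pow_twisted (c := x) (x := c) (v := v⁻¹) (by
        intro g; exact (show Commute v g from hvc g).inv_left) (by
        rw [mul_assoc, hv, mul_assoc, inv_mul_cancel_left]) (2 ^ (k + 1))).1
      rw [h.cent _ h5 x, mul_assoc] at h6
      have := right_eq_mul.1 h6
      rwa [inv_pow, inv_eq_one] at this
  · left
    have hodd' : Odd (p ^ k) := hodd.pow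
    obtain ⟨r, hr⟩ := hodd'
    have : (p ^ k).choose 2 = p ^ k * r := by
      rw [Nat.choose_two_right, hr, Nat.add_sub_cancel, ← mul_assoc, mul_comm (2 * r + 1) 2,
        mul_assoc, Nat.mul_div_cancel_left _ (by norm_num)]
    rw [this, pow_mul, hvq, one_pow, one_mul] at hcq
    exact h.tors_dvd hcq hqn

theorem sq_eq_neg_one {D : Type*} [DivisionRing D] {a b : D} (hab : a * b = b * a)
    (ha : a * a = -1) (hb : b * b = -1) : a = b ∨ a = -b := by
  have : (a - b) * (a + b) = 0 := by
    rw [sub_mul, mul_add, mul_add, ha, hb, hab]; abel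
  rcases mul_eq_zero.1 this with h | h
  · exact Or.inl (sub_eq_zero.1 h)
  · exact Or.inr (eq_neg_of_add_eq_zero_left h)

/-- No quaternions in the presence of a primitive cube root of unity. -/
theorem no_quaternion {D : Type*} [DivisionRing D] [CharZero D] {i j w : D}
    (hi : i * i = -1) (hj : j * j = -1) (hij : j * i = -(i * j))
    (hw : ∀ x, w * x = x * w) (hw3 : w * w + w + 1 = 0) : False := by
  have hww : w * w = -w - 1 := by
    rw [eq_comm, ← sub_eq_zero, ← neg_eq_zero, ← hw3]; abel
  have hw4 : (w * w) * (w * w) = w := by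
    have : w * (w * w) = 1 := by rw [hww, mul_sub, mul_neg, hww]; simp
    rw [mul_assoc, this, mul_one]
  have hw2 : ∀ x, w * w * x = x * (w * w) := by
    intro x; rw [mul_assoc, hw, mul_assoc, hw, mul_assoc]
  have hw0 : w ≠ 0 := by
    rintro rfl
    simp at hw3
  have hq : (w * w * i + w * j) * (w * w * i + w * j) = 1 := by
    have e1 : w * w * i * (w * w * i) = -w := by
      rw [Commute.mul_mul_mul_comm (hw2 i).symm, hw4, hi]; simp
    have e2 : w * j * (w * j) = -(w * w) := by
      rw [Commute.mul_mul_mul_comm (hw j).symm, hj]; simp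
    have e3 : w * w * i * (w * j) = w * w * w * (i * j) := by
      rw [Commute.mul_mul_mul_comm (hw i).symm]
    have e4 : w * j * (w * w * i) = -(w * w * w * (i * j)) := by
      rw [Commute.mul_mul_mul_comm (hw2 j).symm, hij, ← mul_assoc, mul_neg]
    rw [mul_add, add_mul, add_mul, e1, e2, e3, e4, hww]
    abel
  have hs : (w * w * i + w * j) * i = i * (w * w * i + w * j) := by
    have : (w * w * i + w * j - 1) * (w * w * i + w * j + 1) = 0 := by
      rw [sub_mul, mul_add, hq, mul_one, one_mul]; abel
    rcases mul_eq_zero.1 this with h | h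
    · rw [sub_eq_zero.1 h]; simp
    · rw [eq_neg_of_add_eq_zero_left h]; simp
  rw [add_mul, mul_add, ← mul_assoc i, ← hw2 i, add_right_inj, ← mul_assoc i, ← hw i, mul_assoc,
    mul_assoc, hij] at hs
  have h2 := mul_left_cancel₀ hw0 hs
  rw [neg_eq_self] at h2
  rcases mul_eq_zero.1 h2 with h0 | h0
  · rw [h0] at hi; simp at hi
  · rw [h0] at hj; simp at hj

theorem CoreData.normalize [CharZero D] (h : CoreData ι π ζ n) {x y : Γ} {p : ℕ} (hp : p.Prime)
    (P : Subgroup H) (hPc : ∀ a ∈ P, ∀ b ∈ P, a * b = b * a) (hx : π x ∈ P)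
    (hxp : ∃ k, orderOf (π x) = p ^ k) (hy : ∀ a ∈ P, π y * a * (π y)⁻¹ ∈ P)
    (hcop : p.Coprime (orderOf (π y))) : Commute (π y) (π x) := by
  obtain ⟨k, hk⟩ := hxp
  obtain ⟨c, hcd⟩ : ∃ c, c = y * x * y⁻¹ * x⁻¹ := ⟨_, rfl⟩
  have hyx : y * x = c * x * y := by rw [hcd]; group
  have hcP : π c ∈ P := by
    rw [hcd, map_mul, map_mul, map_mul, map_inv, map_inv]
    exact P.mul_mem (hy _ hx) (P.inv_mem hx)
  have hfin : π c = 1 → Commute (π y) (π x) := by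
    intro h1
    have := congrArg π hyx
    rw [map_mul, map_mul, map_mul, h1, one_mul] at this
    exact this
  have hcomm : ∀ a b, π a ∈ P → π b ∈ P → π (a * b * a⁻¹ * b⁻¹) = 1 := by
    intro a b ha hb
    simp only [map_mul, map_inv]
    rw [hPc _ ha _ hb]; group
  obtain ⟨v, hvd⟩ : ∃ v, v = x * c * x⁻¹ * c⁻¹ := ⟨_, rfl⟩
  have hv1 : π v = 1 := by rw [hvd]; exact hcomm x c hx hcP
  rcases h.conj_cases hp hk hyx (v := v) (by rw [hvd]; group) hv1 with h1 | h1
  · exact hfin h1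
  obtain ⟨rfl, hx2, hcv, hv2, hvne⟩ := h1
  have hodd : (orderOf (π y)).Coprime 2 := hcop.symm
  have hπc2 : π c * π c = 1 := by rw [← map_mul, ← pow_two, hcv, hv1]
  have signs : ∀ z : Γ, z ^ 2 = 1 → ι z = 1 ∨ ι z = -1 := by
    intro z hz
    have : ι z * ι z = 1 := by rw [← map_mul, ← pow_two, hz, map_one]
    exact mul_self_eq_one_iff.1 this
  have hιv : ι v = -1 := by
    rcases signs v hv2 with h1 | h1
    · exact absurd (h.inj (by rw [h1, map_one])) hvne
    · exact h1
  -- if `y` commutes with `c` modulo the kernel, we are done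
  have hyc_done : Commute (π y) (π c) → Commute (π y) (π x) := by
    intro hyc
    refine commute_of_pow_coprime (m := 2) ?_ hodd
    have h1 : π y * π x = π c * π x * π y := by
      rw [← map_mul, hyx, map_mul, map_mul]
    change π y ^ 2 * π x = π x * π y ^ 2
    rw [pow_two, mul_assoc, h1, mul_assoc, ← mul_assoc (π y) (π c), hyc.eq, mul_assoc,
      ← mul_assoc (π y), h1, ← mul_assoc, ← mul_assoc, ← mul_assoc, hπc2, one_mul, mul_assoc]
  obtain ⟨c', hc'd⟩ : ∃ c', c' = y * c * y⁻¹ := ⟨_, rfl⟩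
  obtain ⟨c'', hc''d⟩ : ∃ c'', c'' = y * c' * y⁻¹ := ⟨_, rfl⟩
  have hc'P : π c' ∈ P := by
    rw [hc'd, map_mul, map_mul, map_inv]; exact hy _ hcP
  have hc''P : π c'' ∈ P := by
    rw [hc''d, map_mul, map_mul, map_inv]; exact hy _ hc'P
  have hvy : y * v * y⁻¹ = v := by rw [← h.cent v hv1 y, mul_inv_cancel_right]
  have hc'v : c' ^ 2 = v := by rw [hc'd, conj_pow, hcv, hvy]
  have hc''v : c'' ^ 2 = v := by rw [hc''d, conj_pow, hc'v, hvy]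
  have sqs : ∀ a : Γ, a ^ 2 = v → ι a * ι a = -1 := by
    intro a ha
    rw [← map_mul, ← pow_two, ha, hιv]
  -- commutation up to sign
  have hsign : ∀ a b : Γ, π a ∈ P → π b ∈ P → b ^ 2 = v →
      a * b = b * a ∨ ι a * ι b = -(ι b * ι a) := by
    intro a b ha hb hbv
    obtain ⟨δ, hδ⟩ : ∃ δ, δ = a * b * a⁻¹ * b⁻¹ := ⟨_, rfl⟩
    have hδ1 : π δ = 1 := by rw [hδ]; exact hcomm a b ha hb
    have hab : a * b = δ * b * a := by rw [hδ]; group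
    have hδ2 : δ ^ 2 = 1 := by
      have e1 : a * b * a⁻¹ = δ * b := by rw [hδ]; group
      have e2 : (a * b * a⁻¹) ^ 2 = (δ * b) ^ 2 := by rw [e1]
      rw [conj_pow, (show Commute δ b from h.cent δ hδ1 b).mul_pow, hbv, ← h.cent v hv1 a,
        mul_inv_cancel_right] at e2
      exact right_eq_mul.1 e2
    rcases signs δ hδ2 with h1 | h1
    · left
      have : δ = 1 := h.inj (by rw [h1, map_one])
      rw [hab, this, one_mul]
    · right
      rw [← map_mul, hab, map_mul, map_mul, h1]
      simp
  have hyc : y * c = c' * y := by rw [hc'd]; group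
  have hyc' : y * c' = c'' * y := by rw [hc''d]; group
  rcases hsign c' c hc'P hcP hcv with hcc | hanti
  · -- commuting case
    apply hyc_done
    have := h.kummer (g := y) (a := c) (c := c' * c⁻¹) (by rw [inv_mul_cancel_right, hyc])
      (by rw [inv_mul_cancel_right, ← mul_assoc, ← hcc, mul_inv_cancel_right])
    rw [map_mul, map_inv, mul_inv_eq_one] at this
    change π y * π c = π c * π y
    rw [← map_mul, hyc, map_mul, this]
  -- quaternion case
  exfalso
  have hnc : ¬ Commute (π y) (π c) := by
    intro hco
    have e1 : π c' = π c := by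
      rw [hc'd, map_mul, map_mul, map_inv, hco.eq, mul_inv_cancel_right]
    have e2 : π (c' * c⁻¹) = 1 := by rw [map_mul, map_inv, e1, mul_inv_cancel]
    have e3 := h.cent _ e2 c
    rw [inv_mul_cancel_right, ← mul_assoc, eq_mul_inv_iff_mul_eq] at e3
    rw [← map_mul, ← map_mul, e3, map_mul, self_eq_neg] at hanti
    have e4 := sqs c hcv
    have e5 := sqs c' hc'v
    rcases mul_eq_zero.1 hanti with h0 | h0
    · rw [h0] at e4; simp at e4
    · rw [h0] at e5; simp at e5
  by_cases h3 : 3 ∣ n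
  · -- cube root of unity
    obtain ⟨m, hm⟩ := h3
    have hm0 : 0 < m := by
      rcases Nat.eq_zero_or_pos m with h0 | h0
      · have := h.npos; rw [hm, h0] at this; simp at this
      · exact h0
    have hcen : ∀ x, ζ ^ m * x = x * ζ ^ m := fun x =>
      (show Commute ζ x from h.zcen x).pow_left m
    have hne : ζ ^ m ≠ 1 := by
      apply pow_ne_one_of_lt_orderOf hm0.ne'
      rw [h.ord]; omega
    have hcube : ζ ^ m * ζ ^ m * ζ ^ m = 1 := by
      rw [← pow_add, ← pow_add, show m + m + m = n by omega, ← h.ord, pow_orderOf_eq_one]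
    refine no_quaternion (sqs c hcv) (sqs c' hc'v) hanti hcen ?_
    have : (ζ ^ m - 1) * (ζ ^ m * ζ ^ m + ζ ^ m + 1) = 0 := by
      rw [sub_mul, mul_add, mul_add, ← mul_assoc, hcube, mul_one, one_mul]; abel
    rcases mul_eq_zero.1 this with h0 | h0
    · exact absurd (sub_eq_zero.1 h0) hne
    · exact h0
  · have hy3 : (orderOf (π y)).Coprime 3 := by
      rw [Nat.coprime_comm, Nat.Prime.coprime_iff_not_dvd Nat.prime_three]
      intro hd
      exact h3 (hd.trans (orderOf_dvd_of_pow_eq_one (h.exp _)))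
    have hneg : ∀ a b : Γ, ι a = ι b ∨ ι a = -ι b → π a = π b := by
      rintro a b (h1 | h1)
      · rw [h.inj h1]
      · have : a = v * b := h.inj (by rw [h1, map_mul, hιv]; simp)
        rw [this, map_mul, hv1, one_mul]
    have hπ1 : π y * π c = π c' * π y := by rw [← map_mul, hyc, map_mul]
    have hπ2 : π y * π c' = π c'' * π y := by rw [← map_mul, hyc', map_mul]
    have hπc'2 : π c' * π c' = 1 := by rw [← map_mul, ← pow_two, hc'v, hv1]
    -- conjugated anticommutation
    have hanti' : ι c'' * ι c' = -(ι c' * ι c'') := by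
      have e : c' * c = v * c * c' := h.inj (by
        rw [map_mul, map_mul, map_mul, hanti, hιv]; simp)
      have e' : c'' * c' = v * c' * c'' := by
        have : y * (c' * c) * y⁻¹ = y * (v * c * c') * y⁻¹ := by rw [e]
        have e1 : y * (c' * c) * y⁻¹ = c'' * c' := by rw [hc''d, hc'd]; group
        have e2 : y * (v * c * c') * y⁻¹ = (y * v * y⁻¹) * c' * c'' := by rw [hc''d, hc'd]; group
        rw [e1, e2, hvy] at this
        exact this
      rw [← map_mul, e', map_mul, map_mul, hιv]; simp
    rcases hsign c'' c hc''P hcP hcv with hcc | hanti2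
    · apply hnc
      refine commute_of_pow_coprime (m := 2) ?_ hodd
      have e1 : π c'' = π c := hneg _ _ (sq_eq_neg_one (by rw [← map_mul, hcc, map_mul])
        (sqs _ hc''v) (sqs _ hcv))
      change π y ^ 2 * π c = π c * π y ^ 2
      rw [pow_two, mul_assoc, hπ1, ← mul_assoc, hπ2, e1, mul_assoc]
    · apply hnc
      refine commute_of_pow_coprime (m := 3) ?_ hy3
      have e0 : ι c'' * (ι c * ι c') = (ι c * ι c') * ι c'' := by
        rw [← mul_assoc, hanti2, neg_mul, mul_assoc, hanti', mul_neg, neg_neg, mul_assoc]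
      have e1 : ι (c * c') * ι (c * c') = -1 := by
        rw [map_mul, mul_assoc, ← mul_assoc (ι c'), hanti, neg_mul, mul_neg, mul_assoc,
          sqs _ hc'v, mul_neg, mul_neg, neg_neg, mul_one, sqs _ hcv]
      have e2 : π c'' = π c * π c' := by
        rw [← map_mul]
        exact hneg _ _ (sq_eq_neg_one (by rw [map_mul, e0]) (sqs _ hc''v) e1)
      change π y ^ 3 * π c = π c * π y ^ 3
      rw [e2] at hπ2
      have e3 : π c' * (π c * π c') = π c := by
        rw [hPc _ hcP _ hc'P, ← mul_assoc, hπc'2, one_mul]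
      calc π y ^ 3 * π c = π y * (π y * (π y * π c)) := by rw [pow_three]; simp only [mul_assoc]
        _ = π y * (π y * π c') * π y := by rw [hπ1]; simp only [mul_assoc]
        _ = (π y * π c) * π c' * π y * π y := by rw [hπ2]; simp only [mul_assoc]
        _ = π c' * (π y * π c') * π y * π y := by rw [hπ1]; simp only [mul_assoc]
        _ = π c' * (π c * π c') * (π y * (π y * π y)) := by rw [hπ2]; simp only [mul_assoc]
        _ = π c * π y ^ 3 := by rw [e3, pow_three]

theorem CoreData.comm [CharZero D] [Finite H] (h : CoreData ι π ζ n) (a b : H) : a * b = b * a := by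
  have hsyl : ∀ p : ℕ, ∀ hp : p.Prime, ∀ P : Sylow p H,
      Subgroup.normalizer (P : Set H) ≤ Subgroup.centralizer (P : Set H) := by
    intro p hp P y hy
    have : Fact p.Prime := ⟨hp⟩
    have hPc := h.pGroup_comm hp P P.2
    rw [Subgroup.mem_centralizer_iff]
    intro x hx
    have hy' : y ∈ Subgroup.normalizer ((P : Subgroup H) : Set H) := hy
    obtain ⟨s, m, hm, hs⟩ := Nat.exists_eq_pow_mul_and_not_dvd (n := orderOf y)
      (orderOf_pos y).ne' p hp.ne_one
    have hpm : p.Coprime m := (Nat.Prime.coprime_iff_not_dvd hp).2 hm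
    have hcop : (p ^ s).Coprime m := hpm.pow_left s
    have hpx : ∃ k, orderOf x = p ^ k := by
      obtain ⟨k, hk⟩ := IsPGroup.iff_orderOf.1 P.2 ⟨x, hx⟩
      exact ⟨k, by rw [← hk]; exact (Subgroup.orderOf_mk x hx).symm⟩
    have c1 : Commute (y ^ p ^ s) x := by
      obtain ⟨x', hx'⟩ := h.surj x
      obtain ⟨y', hy''⟩ := h.surj (y ^ p ^ s)
      have hyn : y ^ p ^ s ∈ Subgroup.normalizer ((P : Subgroup H) : Set H) :=
        Subgroup.pow_mem _ hy' _
      rw [← hx', ← hy'']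
      refine h.normalize hp P hPc (by rw [hx']; exact hx) ?_ ?_ ?_
      · rw [hx']
        exact hpx
      · intro a ha
        rw [hy'']
        exact (Subgroup.mem_normalizer_iff.1 hyn a).1 ha
      · rw [hy'']
        refine Nat.Coprime.coprime_dvd_right (orderOf_dvd_of_pow_eq_one ?_) hpm
        rw [← pow_mul, ← hs, pow_orderOf_eq_one]
    have c2 : Commute (y ^ m) x := by
      have hz : IsPGroup p (Subgroup.zpowers (y ^ m)) := by
        apply IsPGroup.of_card (n := s)
        rw [Nat.card_zpowers, orderOf_pow_of_dvd, hs, Nat.mul_div_cancel]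
        · exact Nat.pos_of_ne_zero (fun h0 => hm (h0 ▸ dvd_zero p))
        · exact fun h0 => hm (h0 ▸ dvd_zero p)
        · rw [hs]; exact dvd_mul_left _ _
      have hle : Subgroup.zpowers (y ^ m) ≤ Subgroup.normalizer ((P : Subgroup H) : Set H) := by
        rw [Subgroup.zpowers_le]
        exact Subgroup.pow_mem _ hy' _
      have hsup := IsPGroup.to_sup_of_normal_right' hz P.2 hle
      exact h.pGroup_comm hp _ hsup _ (Subgroup.mem_sup_left (Subgroup.mem_zpowers _)) _
        (Subgroup.mem_sup_right hx)
    have hb := Nat.gcd_eq_gcd_ab (p ^ s) m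
    rw [hcop.gcd_eq_one] at hb
    have hy1 : y = (y ^ p ^ s) ^ (Nat.gcdA (p ^ s) m) * (y ^ m) ^ (Nat.gcdB (p ^ s) m) := by
      rw [← zpow_natCast y (p ^ s), ← zpow_natCast y m, ← zpow_mul, ← zpow_mul, ← zpow_add, ← hb]
      simp
    have hc : Commute y x := by
      rw [hy1]
      exact (c1.zpow_left _).mul_left (c2.zpow_left _)
    exact hc.eq.symm
  have ht : orderOf (a * b * a⁻¹ * b⁻¹) = 1 := by
    rw [Nat.eq_one_iff_not_exists_prime_dvd]
    intro p hp hd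
    have : Fact p.Prime := ⟨hp⟩
    obtain ⟨P⟩ : Nonempty (Sylow p H) := inferInstance
    have hPc := h.pGroup_comm hp P P.2
    have hmem : a * b * a⁻¹ * b⁻¹ ∈ (MonoidHom.transferSylow P (hsyl p hp P)).ker := by
      rw [MonoidHom.mem_ker]
      have hcm : ∀ u w : P, u * w = w * u := fun u w => Subtype.ext (hPc _ u.2 _ w.2)
      simp only [map_mul, map_inv]
      rw [hcm (MonoidHom.transferSylow P (hsyl p hp P) a), mul_inv_cancel_right, mul_inv_cancel]
    apply MonoidHom.not_dvd_card_ker_transferSylow P (hsyl p hp P)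
    refine hd.trans ?_
    rw [← Subgroup.orderOf_mk _ hmem]
    exact orderOf_dvd_natCard _
  rw [orderOf_eq_one_iff, mul_inv_eq_one, mul_inv_eq_iff_eq_mul] at ht
  exact ht

end
end HsetAux
namespace HsetAux
section Main

theorem grading_indep {G : Type*} [Group G] [DecidableEq G] {D : Type*} [DivisionRing D]
    [Fintype G] {𝒜 : G → AddSubgroup D} (hG : IsFaithfulGrading 𝒜)
    (a : G → D) (ha : ∀ g, a g ∈ 𝒜 g) (h0 : ∑ g, a g = 0) (g : G) : a g = 0 := by
  have h1 : (∑ k, DirectSum.of (fun i => 𝒜 i) k ⟨a k, ha k⟩) = 0 := by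
    apply hG.isInternal.injective
    rw [map_sum, map_zero, ← h0]
    exact Finset.sum_congr rfl fun k _ => DirectSum.coeAddMonoidHom_of 𝒜 k _
  have h2 := DirectSum.sum_univ_of (∑ k, DirectSum.of (fun i => 𝒜 i) k ⟨a k, ha k⟩)
  have h3 := congrArg (fun z : DirectSum G (fun i => 𝒜 i) => (z g : D)) h1
  simp only [DirectSum.zero_apply] at h3
  rw [DFinsupp.finsetSum_apply] at h3
  rw [Finset.sum_eq_single g] at h3
  · simpa [DirectSum.of_eq_same] using h3
  · intro b _ hb
    exact DirectSum.of_eq_of_ne _ _ _ hb.symm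
  · simp

theorem grading_span {G : Type*} [Group G] [DecidableEq G] {D : Type*} [DivisionRing D]
    [Fintype G] {𝒜 : G → AddSubgroup D} (hG : IsFaithfulGrading 𝒜) (x : D) :
    ∃ a : G → D, (∀ g, a g ∈ 𝒜 g) ∧ x = ∑ g, a g := by
  obtain ⟨f, rfl⟩ := hG.isInternal.surjective x
  refine ⟨fun g => f g, fun g => (f g).2, ?_⟩
  conv_lhs => rw [← DirectSum.sum_univ_of f]
  rw [map_sum]
  exact Finset.sum_congr rfl fun k _ => DirectSum.coeAddMonoidHom_of 𝒜 k _

theorem grading_unique {G : Type*} [Group G] [DecidableEq G] {D : Type*} [DivisionRing D]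
    [Fintype G] {𝒜 : G → AddSubgroup D} (hG : IsFaithfulGrading 𝒜) {x : D} (hx : x ≠ 0)
    {g k : G} (hg : x ∈ 𝒜 g) (hk : x ∈ 𝒜 k) : g = k := by
  by_contra hne
  have := grading_indep hG (fun j => (if j = g then x else 0) - (if j = k then x else 0))
    (fun j => (𝒜 j).sub_mem (by split_ifs with h; exacts [h ▸ hg, (𝒜 j).zero_mem])
      (by split_ifs with h; exacts [h ▸ hk, (𝒜 j).zero_mem])) (by simp) g
  simp [hne] at this
  exact hx this

theorem grading_inv {G : Type*} [Group G] [DecidableEq G] {D : Type*} [DivisionRing D]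
    [Fintype G] {𝒜 : G → AddSubgroup D} (hG : IsFaithfulGrading 𝒜) {x : D} (hx : x ≠ 0)
    {g : G} (hg : x ∈ 𝒜 g) : x⁻¹ ∈ 𝒜 g⁻¹ := by
  obtain ⟨y, hy, hxy⟩ := grading_span hG x⁻¹
  have := grading_indep hG (fun j => x * y (g⁻¹ * j) - (if j = 1 then 1 else 0))
    (fun j => (𝒜 j).sub_mem (by
        have := hG.mul_mem hg (hy (g⁻¹ * j))
        rwa [mul_inv_cancel_left] at this)
      (by split_ifs with h; exacts [h ▸ hG.one_mem, (𝒜 j).zero_mem])) (by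
        rw [Finset.sum_sub_distrib, ← Finset.mul_sum,
          show ∑ i, y (g⁻¹ * i) = ∑ i, y i from Equiv.sum_comp (Equiv.mulLeft g⁻¹) y, ← hxy, mul_inv_cancel₀ hx]
        simp) 1
  simp only [mul_one, if_true] at this
  rw [sub_eq_zero] at this
  rw [inv_eq_of_mul_eq_one_right this]
  exact hy _

/-- The identity component as a subring. -/
def oneComp {G : Type*} [Group G] [DecidableEq G] {D : Type*} [DivisionRing D]
    {𝒜 : G → AddSubgroup D} (hG : IsFaithfulGrading 𝒜) : Subring D where
  carrier := 𝒜 1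
  mul_mem' {a b} ha hb := by
    have := hG.mul_mem (g := 1) (h := 1) ha hb
    rwa [mul_one] at this
  one_mem' := hG.one_mem
  add_mem' := (𝒜 1).add_mem
  zero_mem' := (𝒜 1).zero_mem
  neg_mem' := (𝒜 1).neg_mem

theorem exists_cent {G : Type*} [Group G] [DecidableEq G] {D : Type*} [DivisionRing D]
    [Fintype G] {𝒜 : G → AddSubgroup D} (hG : IsFaithfulGrading 𝒜)
    [Module.Finite ↥(Subring.center D) D] {g : G} (hg : g ∈ Hset 𝒜) :
    ∃ u ∈ 𝒜 g, u ≠ 0 ∧ ∀ e ∈ 𝒜 1, e * u = u * e := by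
  have hinv : ∀ x ∈ oneComp hG, x⁻¹ ∈ oneComp hG := by
    intro x hx
    by_cases h0 : x = 0
    · rw [h0, inv_zero]; exact (oneComp hG).zero_mem
    · have := grading_inv hG h0 (show x ∈ 𝒜 1 from hx)
      rwa [inv_one] at this
  let E : Subfield D := { oneComp hG with inv_mem' := hinv }
  have hE : ∀ x, x ∈ E ↔ x ∈ 𝒜 1 := fun x => Iff.rfl
  have hne : ∀ k, ∃ u ∈ 𝒜 k, u ≠ 0 := fun k => by
    by_contra! hcon
    exact hG.faithful k ((AddSubgroup.eq_bot_iff_forall _).2 hcon)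
  choose u huA hu0 using hne
  have hcen : ∀ x : E, (∀ y, x * y = y * x) →
      ∃ l : Subring.center E, x = algebraMap (Subring.center E) E l := fun x hx =>
    ⟨⟨x, Subring.mem_center_iff.2 fun y => (hx y).symm⟩, rfl⟩
  have hfin : Module.Finite (Subring.center E) E := by
    refine finite_over_center hcen E.subtype u ?_
    intro x
    obtain ⟨a, ha, hx⟩ := grading_span hG x
    refine ⟨fun k => ⟨a k * (u k)⁻¹, ?_⟩, ?_⟩
    · have := hG.mul_mem (ha k) (grading_inv hG (hu0 k) (huA k))
      rw [mul_inv_cancel] at this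
      exact this
    · rw [finsum_eq_sum_of_fintype, hx]
      refine Finset.sum_congr rfl fun k _ => ?_
      exact (inv_mul_cancel_right₀ (hu0 k) (a k)).symm
  obtain ⟨d, hd0, hd⟩ := exists_centralizing hcen E.subtype (u g) (hu0 g) (by
      intro l
      refine (hg (u g) (huA g) _ ⟨(l : E).2, ?_⟩).symm
      intro y hy
      exact congrArg Subtype.val (Subring.mem_center_iff.1 l.2 ⟨y, hy⟩).symm) (by
      intro e
      refine ⟨⟨u g * e * (u g)⁻¹, ?_⟩, ?_⟩
      · have := hG.mul_mem (hG.mul_mem (huA g) e.2) (grading_inv hG (hu0 g) (huA g))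
        rw [mul_one, mul_inv_cancel] at this
        exact this
      · exact (inv_mul_cancel_right₀ (hu0 g) _).symm)
  refine ⟨d * u g, ?_, mul_ne_zero (fun h0 => hd0 (Subtype.ext h0)) (hu0 g), fun e he => hd ⟨e, he⟩⟩
  have := hG.mul_mem d.2 (huA g)
  rwa [one_mul] at this

/-- Pairs of a unit of degree `g` centralizing the identity component, and `g`. -/
def centPairs {G : Type*} [Group G] [DecidableEq G] {D : Type*} [DivisionRing D]
    [Fintype G] {𝒜 : G → AddSubgroup D} (hG : IsFaithfulGrading 𝒜) : Subgroup (Dˣ × G) where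
  carrier := {p | (p.1 : D) ∈ 𝒜 p.2 ∧ ∀ e ∈ 𝒜 1, e * (p.1 : D) = p.1 * e}
  mul_mem' {a b} ha hb := by
    refine ⟨?_, fun e he => ?_⟩
    · simpa using hG.mul_mem ha.1 hb.1
    · change e * ((a.1 : D) * b.1) = a.1 * b.1 * e
      rw [← mul_assoc, ha.2 e he, mul_assoc, hb.2 e he, mul_assoc]
  one_mem' := ⟨by simpa using hG.one_mem, by simp⟩
  inv_mem' {a} ha := by
    refine ⟨?_, fun e he => ?_⟩
    · simpa using grading_inv hG a.1.ne_zero ha.1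
    · have : Commute e (a.1 : D) := ha.2 e he
      exact this.units_inv_right.eq

theorem main_aux {G : Type*} [Group G] [DecidableEq G] {D : Type*} [DivisionRing D]
    [Finite G] [CharZero D]
    (𝒜 : G → AddSubgroup D) (hG : IsFaithfulGrading 𝒜)
    [Module.Finite ↥(Subring.center D) D]
    (ζ : D) (hζK : ζ ∈ Subring.center D) (hζe : ζ ∈ 𝒜 1)
    (hζ : orderOf ζ = Monoid.exponent G) :
    ∃ H : Subgroup G, (H : Set G) = Hset 𝒜 ∧ H.Normal ∧
      ∀ a ∈ H, ∀ b ∈ H, a * b = b * a := by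
  have : Fintype G := Fintype.ofFinite G
  let π₀ : centPairs hG →* G := (MonoidHom.snd Dˣ G).comp (centPairs hG).subtype
  let ι : centPairs hG →* D :=
    (Units.coeHom D).comp ((MonoidHom.fst Dˣ G).comp (centPairs hG).subtype)
  have hι : ∀ γ : centPairs hG, ι γ ∈ 𝒜 (π₀ γ) := fun γ => γ.2.1
  have hιc : ∀ γ : centPairs hG, ∀ e ∈ 𝒜 1, e * ι γ = ι γ * e := fun γ => γ.2.2
  have hι0 : ∀ γ : centPairs hG, ι γ ≠ 0 := fun γ => γ.1.1.ne_zero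
  have hinj : Function.Injective ι := by
    intro a b hab
    have h1 : a.1.1 = b.1.1 := Units.ext hab
    have h2 : a.1.2 = b.1.2 := grading_unique hG (hι0 a) (hι a) (by rw [hab]; exact hι b)
    exact Subtype.ext (Prod.ext h1 h2)
  have hroot : ∀ i : ℕ, ζ ^ i ∈ 𝒜 1 := fun i => (oneComp hG).pow_mem (x := ζ) hζe i
  have hcore : CoreData ι π₀.rangeRestrict ζ (Monoid.exponent G) := by
    refine ⟨hinj, π₀.rangeRestrict_surjective, ?_, ?_, ?_, hζ, ?_, ?_⟩
    · intro z hz g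
      apply hinj
      have hz1 : π₀ z = 1 := congrArg Subtype.val hz
      have := hι z
      rw [hz1] at this
      rw [map_mul, map_mul, hιc g _ this]
    · intro x
      exact (Subring.mem_center_iff.1 hζK x).symm
    · exact Nat.pos_of_ne_zero Monoid.exponent_ne_zero_of_finite
    · intro h
      exact Subtype.ext (Monoid.pow_exponent_eq_one (h : G))
    · intro γ i hγ
      apply Subtype.ext
      exact grading_unique hG (hι0 γ) (hι γ) (by rw [hγ]; exact hroot i)
  have hrange : (π₀.range : Set G) = Hset 𝒜 := by
    ext g
    constructor
    · rintro ⟨γ, rfl⟩ x hx l hl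
      have hxu : x * (ι γ)⁻¹ ∈ 𝒜 1 := by
        have := hG.mul_mem hx (grading_inv hG (hι0 γ) (hι γ))
        rwa [mul_inv_cancel] at this
      have e : x = x * (ι γ)⁻¹ * ι γ := (inv_mul_cancel_right₀ (hι0 γ) x).symm
      rw [e, mul_assoc, ← hιc γ l hl.1, ← mul_assoc, ← hl.2 _ hxu, mul_assoc]
    · intro hg
      obtain ⟨u, hu, hu0, huc⟩ := exists_cent hG hg
      exact ⟨⟨(Units.mk0 u hu0, g), hu, huc⟩, rfl⟩
  refine ⟨π₀.range, hrange, ⟨?_⟩, ?_⟩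
  · intro g hg k
    have hg' : g ∈ Hset 𝒜 := by rw [← hrange]; exact hg
    change k * g * k⁻¹ ∈ (π₀.range : Set G)
    rw [hrange]
    intro x hx l hl
    obtain ⟨y, hy, hy0⟩ : ∃ y ∈ 𝒜 k, y ≠ 0 := by
      by_contra! hcon
      exact hG.faithful k ((AddSubgroup.eq_bot_iff_forall _).2 hcon)
    have hyi := grading_inv hG hy0 hy
    have h1 : y⁻¹ * x * y ∈ 𝒜 g := by
      have := hG.mul_mem (hG.mul_mem hyi hx) hy
      rwa [show k⁻¹ * (k * g * k⁻¹) * k = g by group] at this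
    have h2 : y⁻¹ * l * y ∈ Lset 𝒜 := by
      refine ⟨?_, fun z hz => ?_⟩
      · have := hG.mul_mem (hG.mul_mem hyi hl.1) hy
        rwa [mul_one, inv_mul_cancel] at this
      · have hz' : y * z * y⁻¹ ∈ 𝒜 1 := by
          have := hG.mul_mem (hG.mul_mem hy hz) hyi
          rwa [mul_one, mul_inv_cancel] at this
        have e := congrArg (fun t => y⁻¹ * t * y) (hl.2 _ hz')
        simpa [mul_assoc, hy0] using e
    have e := congrArg (fun t => y * t * y⁻¹) (hg' _ h1 _ h2)
    simpa [mul_assoc, hy0] using e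
  · intro a ha b hb
    exact congrArg Subtype.val (hcore.comm ⟨a, ha⟩ ⟨b, hb⟩)

end Main
end HsetAux

/-- Under the standing hypotheses (division ring `D` of characteristic
zero, finite dimensional over its center `K`, faithfully `G`-graded, `G` finite, and the
`e`-center `K₀ = K ∩ L` containing a primitive `n_G`-th root of unity), the set
`H = {g ∈ G : x·l = l·x for all x ∈ D_g, l ∈ L}` is an abelian normal subgroup of `G`. -/
theorem Hset_is_abelian_normal_subgroup
    [Finite G] [CharZero D]
    (𝒜 : G → AddSubgroup D) (hG : IsFaithfulGrading 𝒜)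
    [Module.Finite ↥(Subring.center D) D]
    (ζ : D) (hζK : ζ ∈ Subring.center D) (hζe : ζ ∈ 𝒜 1)
    (hζ : orderOf ζ = Monoid.exponent G) :
    ∃ H : Subgroup G, (H : Set G) = Hset 𝒜 ∧ H.Normal ∧
      ∀ a ∈ H, ∀ b ∈ H, a * b = b * a := by
  exact HsetAux.main_aux 𝒜 hG ζ hζK hζe hζ
end

section
/- Under the standing hypotheses (with K contained in D_e), the subgroup H is abelian and there exists a finite abelian group A such that H is isomorphic to A × A. -/
variable {G : Type*} [Group G] [DecidableEq G] {D : Type*} [DivisionRing D]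

open scoped commutatorElement

theorem aux_pgroup_comm {Q : Type*} [Group Q] [Group.IsNilpotent Q]
    (hA : ∀ g h : Q, Commute ⁅g, h⁆ g → Commute ⁅g, h⁆ h → ⁅g, h⁆ = 1) (a b : Q) :
    a * b = b * a := by
  have key : ∀ n, Subgroup.upperCentralSeries Q n ≤ Subgroup.center Q := by
    intro n
    induction n with
    | zero => simp
    | succ n ih =>
      intro x hx
      rw [Subgroup.mem_upperCentralSeries_succ_iff] at hx
      rw [Subgroup.mem_center_iff]
      intro y
      have h1 := Subgroup.mem_center_iff.1 (ih (hx y))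
      have := hA x y (h1 x).symm (h1 y).symm
      exact (commutatorElement_eq_one_iff_mul_comm.1 this).symm
  obtain ⟨n, hn⟩ := Group.IsNilpotent.nilpotent Q
  have := key n (hn ▸ Subgroup.mem_top a)
  exact (Subgroup.mem_center_iff.1 this b).symm

theorem aux_commute_of_coprime_pow {H : Type*} [Group H] {a n : H} {r s : ℕ}
    (hrs : r.Coprime s) (h1 : Commute a (n ^ r)) (h2 : Commute a (n ^ s)) : Commute a n := by
  have h := Nat.gcd_eq_gcd_ab r s
  rw [hrs] at h
  have : n = (n ^ r) ^ (r.gcdA s) * (n ^ s) ^ (r.gcdB s) := by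
    rw [← zpow_natCast, ← zpow_natCast, ← zpow_mul, ← zpow_mul, ← zpow_add, ← h]
    simp
  rw [this]
  exact (h1.zpow_right _).mul_right (h2.zpow_right _)

theorem aux_comm_of_props {H : Type*} [Group H] [Finite H]
    (hA : ∀ g h : H, Commute ⁅g, h⁆ g → Commute ⁅g, h⁆ h → ⁅g, h⁆ = 1)
    (hB : ∀ p : ℕ, p.Prime → ∀ P : Subgroup H, IsPGroup p P →
      (∀ a ∈ P, ∀ b ∈ P, a * b = b * a) → ∀ q ∈ Subgroup.normalizer (P : Set H),
      (orderOf q).Coprime p → ∀ a ∈ P, Commute a q) (a b : H) : a * b = b * a := by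
  rw [← commutatorElement_eq_one_iff_mul_comm, ← orderOf_eq_one_iff]
  by_contra hne
  obtain ⟨p, hp, hpd⟩ := Nat.exists_prime_and_dvd hne
  have : Fact p.Prime := ⟨hp⟩
  obtain ⟨P⟩ : Nonempty (Sylow p H) := inferInstance
  have hPc : ∀ a ∈ P, ∀ b ∈ P, a * b = b * a := by
    have : Group.IsNilpotent P := P.2.isNilpotent
    have := aux_pgroup_comm (Q := P) (by
      intro g h h1 h2
      have := hA g h (by simpa using h1.map (P : Subgroup H).subtype)
        (by simpa using h2.map (P : Subgroup H).subtype)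
      exact Subtype.ext this)
    intro a ha b hb
    simpa using congrArg Subtype.val (this ⟨a, ha⟩ ⟨b, hb⟩)
  have hN : Subgroup.normalizer ((P : Subgroup H) : Set H) ≤ Subgroup.centralizer ((P : Subgroup H) : Set H) := by
    intro n hn
    rw [Subgroup.mem_centralizer_iff]
    intro a ha
    obtain ⟨k, r, hr, hkr⟩ := Nat.exists_eq_pow_mul_and_not_dvd (orderOf_pos n).ne' p hp.ne_one
    have hrp : r.Coprime p := ((Nat.Prime.coprime_iff_not_dvd hp).2 hr).symm
    refine (aux_commute_of_coprime_pow (r := r) (s := p ^ k) (hrp.pow_right k) ?_ ?_ : Commute a n)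
    · have hm : n ^ r ∈ P := by
        have hz : IsPGroup p (Subgroup.zpowers (n ^ r)) := by
          apply IsPGroup.of_card (n := k)
          rw [Nat.card_zpowers, orderOf_pow, hkr]
          simp
          exact Nat.div_eq_of_eq_mul_left (Nat.pos_of_ne_zero (by rintro rfl; simp at hr)) rfl
        have hle : Subgroup.zpowers (n ^ r) ≤ Subgroup.normalizer ((P : Subgroup H) : Set H) := by
          rw [Subgroup.zpowers_le]
          exact pow_mem hn r
        have := IsPGroup.to_sup_of_normal_right' hz P.2 hle
        have h3 := P.3 this le_sup_right
        have : n ^ r ∈ (P : Subgroup H) := by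
          rw [← h3]
          exact Subgroup.mem_sup_left (Subgroup.mem_zpowers _)
        exact this
      exact hPc a ha _ hm
    · apply hB p hp P P.2 hPc _ (pow_mem hn _) _ a ha
      rw [orderOf_pow, hkr]
      simp
      rwa [Nat.mul_div_cancel_left _ (pow_pos hp.pos k)]
  have hk : ⁅a, b⁆ ∈ (MonoidHom.transferSylow P hN).ker := by
    rw [MonoidHom.mem_ker, map_commutatorElement, commutatorElement_eq_one_iff_mul_comm]
    exact Subtype.ext (hPc _ (Subtype.mem _) _ (Subtype.mem _))
  apply MonoidHom.not_dvd_card_ker_transferSylow P hN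
  refine hpd.trans ?_
  rw [← Nat.card_zpowers]
  exact Subgroup.card_dvd_of_le (by simpa using hk)

structure AuxData {D : Type*} [DivisionRing D] {H : Type*} [Group H]
    (Γ : Subgroup Dˣ) (π : Γ →* H) (ζ : D) (e : ℕ) : Prop where
  zc : ∀ d, ζ * d = d * ζ
  root : ∀ d : D, d ^ e = 1 → ∃ k : ℕ, d = ζ ^ k
  exp : ∀ h : H, h ^ e = 1
  ker : ∀ z : Γ, π z = 1 → ∀ y : Γ, z * y = y * z
  cen : ∀ w : Γ, (∀ d : D, ((w : Dˣ) : D) * d = d * ((w : Dˣ) : D)) → π w = 1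
  surj : Function.Surjective π

namespace AuxData
variable {D : Type*} [DivisionRing D] {H : Type*} [Group H]
    {Γ : Subgroup Dˣ} {π : Γ →* H} {ζ : D} {e : ℕ}

theorem zpow_cen (A : AuxData Γ π ζ e) (k : ℕ) (d : D) : ζ ^ k * d = d * ζ ^ k :=
  ((show Commute ζ d from A.zc d).pow_left k)

theorem root_cen (A : AuxData Γ π ζ e) {d : D} (h : d ^ e = 1) (x : D) : d * x = x * d := by
  obtain ⟨k, rfl⟩ := A.root d h
  exact A.zpow_cen k x

theorem pi_one (A : AuxData Γ π ζ e) {w : Γ} (h : w ^ e = 1) : π w = 1 := by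
  apply A.cen
  apply A.root_cen
  have := congrArg (fun z : Γ => ((z : Dˣ) : D)) h
  simpa using this

theorem pow_ker (A : AuxData Γ π ζ e) (x y : Γ) : Commute (x ^ e) y :=
  A.ker _ (by rw [map_pow, A.exp]) y

theorem star (A : AuxData Γ π ζ e) {x y : Γ} (h : Commute x (y * x * y⁻¹)) :
    Commute (π y) (π x) := by
  have h1 : (y * x * y⁻¹ * x⁻¹) ^ e = 1 := by
    rw [(h.symm.inv_right).mul_pow, conj_pow, inv_pow, ← (A.pow_ker x y).eq]
    simp
  have := A.pi_one h1
  simp only [map_mul, map_inv] at this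
  rw [mul_inv_eq_one, mul_inv_eq_iff_eq_mul] at this
  exact this

theorem comm_root (A : AuxData Γ π ζ e) {x y : Γ} (h : Commute (π x) (π y)) : ⁅x, y⁆ ^ e = 1 := by
  have hk : π ⁅x, y⁆ = 1 := by
    rw [map_commutatorElement, commutatorElement_eq_one_iff_mul_comm]; exact h
  have hc : Commute ⁅x, y⁆ y := A.ker _ hk y
  have h1 : x * y * x⁻¹ = ⁅x, y⁆ * y := by rw [commutatorElement_def]; group
  have h2 := congrArg (· ^ e) h1
  simp only [conj_pow, hc.mul_pow] at h2
  rw [← (A.pow_ker y x).eq] at h2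
  simpa using h2

theorem comm_zeta (A : AuxData Γ π ζ e) {x y : Γ} (h : Commute (π x) (π y)) :
    ∃ k : ℕ, ((x : Dˣ) : D) * ((y : Dˣ) : D) = ζ ^ k * (((y : Dˣ) : D) * ((x : Dˣ) : D)) := by
  have h1 := congrArg (fun z : Γ => ((z : Dˣ) : D)) (A.comm_root h)
  obtain ⟨k, hk⟩ := A.root (((⁅x, y⁆ : Γ) : Dˣ) : D) (by simpa using h1)
  refine ⟨k, ?_⟩
  rw [← hk]
  have : x * y = ⁅x, y⁆ * (y * x) := by rw [commutatorElement_def]; group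
  simpa using congrArg (fun z : Γ => ((z : Dˣ) : D)) this

theorem euclid (A : AuxData Γ π ζ e) (t : Γ) (n : ℕ) : ∀ (a b : ℕ) (_ : a + b = n) (x y : Γ)
    (_ : ⁅x, y⁆ = t)
    (_ : ((x : Dˣ) : D) * ((t : Dˣ) : D) = ζ ^ a * (((t : Dˣ) : D) * ((x : Dˣ) : D)))
    (_ : ((y : Dˣ) : D) * ((t : Dˣ) : D) = ζ ^ b * (((t : Dˣ) : D) * ((y : Dˣ) : D))),
    π t = 1 := by
  have hz : ∀ y : Γ, ∀ b : ℕ, 0 < b → ((y : Dˣ) : D) * ((t : Dˣ) : D) =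
      ζ ^ b * (((t : Dˣ) : D) * ((y : Dˣ) : D)) → ζ ≠ 0 := by
    rintro y b hb h rfl
    rw [zero_pow hb.ne', zero_mul] at h
    exact mul_ne_zero (Units.ne_zero _) (Units.ne_zero _) h
  have red : ∀ (x y : Γ) (a b : ℕ), 0 < b → b ≤ a →
    ((x : Dˣ) : D) * ((t : Dˣ) : D) = ζ ^ a * (((t : Dˣ) : D) * ((x : Dˣ) : D)) →
    ((y : Dˣ) : D) * ((t : Dˣ) : D) = ζ ^ b * (((t : Dˣ) : D) * ((y : Dˣ) : D)) →
    (((x * y⁻¹ : Γ) : Dˣ) : D) * ((t : Dˣ) : D) =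
      ζ ^ (a - b) * (((t : Dˣ) : D) * (((x * y⁻¹ : Γ) : Dˣ) : D)) := by
    intro x y a b hb hba hx hy
    have hz0 := hz y b hb hy
    have hy0 : ((y : Dˣ) : D) ≠ 0 := Units.ne_zero _
    simp only [Subgroup.coe_mul, Subgroup.coe_inv, Units.val_mul, Units.val_inv_eq_inv_val]
    generalize ((x : Dˣ) : D) = X at *
    generalize ((y : Dˣ) : D) = Y at *
    generalize ((t : Dˣ) : D) = T at *
    -- X Y⁻¹ T = ζ^(a-b) T X Y⁻¹
    have hb0 : ζ ^ b ≠ 0 := pow_ne_zero _ hz0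
    have e1 : ζ ^ b * (Y⁻¹ * T) = T * Y⁻¹ := by
      have : Y * (ζ ^ b * (Y⁻¹ * T)) * Y = Y * (T * Y⁻¹) * Y := by
        rw [← mul_assoc Y, ← A.zpow_cen, mul_assoc, mul_assoc]
        rw [mul_assoc Y⁻¹ T Y, mul_inv_cancel_left₀ hy0, ← hy, mul_assoc, mul_assoc,
          inv_mul_cancel₀ hy0, mul_one]
      exact mul_left_cancel₀ hy0 (mul_right_cancel₀ hy0 this)
    apply mul_left_cancel₀ hb0
    rw [← mul_assoc (ζ ^ b) (ζ ^ (a - b)), ← pow_add, Nat.add_sub_cancel' hba,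
      mul_assoc, ← mul_assoc (ζ ^ b), A.zpow_cen b X, mul_assoc, e1, ← mul_assoc, hx]
    simp only [mul_assoc]
  induction n using Nat.strong_induction_on with
  | _ n ih =>
  intro a b hab x y hxy hx hy
  have hxt : x * y * x⁻¹ = t * y := by rw [← hxy, commutatorElement_def]; group
  have hyt : y * x⁻¹ * y⁻¹ = x⁻¹ * t := by rw [← hxy, commutatorElement_def]; group
  rcases Nat.eq_zero_or_pos a with rfl | ha
  · have hc : Commute x t := by
      apply Subtype.ext; apply Units.ext
      simpa using hx
    have := A.star (x := x⁻¹) (y := y) (by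
      rw [hyt]
      exact (Commute.refl _).mul_right hc.inv_left)
    rw [← hxy, map_commutatorElement, commutatorElement_eq_one_iff_mul_comm]
    rw [map_inv] at this
    exact Commute.inv_left_iff.1 this.symm
  rcases Nat.eq_zero_or_pos b with rfl | hb
  · have hc : Commute y t := by
      apply Subtype.ext; apply Units.ext
      simpa using hy
    have := A.star (x := y) (y := x) (by
      rw [hxt]
      exact hc.mul_right (Commute.refl _))
    rw [← hxy, map_commutatorElement, commutatorElement_eq_one_iff_mul_comm]
    exact this
  rcases le_total b a with hle | hle
  · exact ih (a - b + b) (by omega) (a - b) b rfl (x * y⁻¹) y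
      (by rw [← hxy]; simp only [commutatorElement_def]; group) (red x y a b hb hle hx hy) hy
  · exact ih (a + (b - a)) (by omega) a (b - a) rfl x (y * x⁻¹)
      (by rw [← hxy]; simp only [commutatorElement_def]; group) hx (red y x b a ha hle hy hx)

theorem propA (A : AuxData Γ π ζ e) (g h : H) (hg : Commute ⁅g, h⁆ g) (hh : Commute ⁅g, h⁆ h) :
    ⁅g, h⁆ = 1 := by
  obtain ⟨x, rfl⟩ := A.surj g
  obtain ⟨y, rfl⟩ := A.surj h
  rw [← map_commutatorElement] at *
  obtain ⟨a, ha⟩ := A.comm_zeta hg.symm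
  obtain ⟨b, hb⟩ := A.comm_zeta hh.symm
  exact A.euclid ⁅x, y⁆ _ a b rfl x y rfl ha hb

theorem comm_root' (A : AuxData Γ π ζ e) {x y : Γ} (h : Commute (π x) (π y)) {f : ℕ}
    (hf : π y ^ f = 1) : ⁅x, y⁆ ^ f = 1 := by
  have hk : π ⁅x, y⁆ = 1 := by
    rw [map_commutatorElement, commutatorElement_eq_one_iff_mul_comm]; exact h
  have hc : Commute ⁅x, y⁆ y := A.ker _ hk y
  have h1 : x * y * x⁻¹ = ⁅x, y⁆ * y := by rw [commutatorElement_def]; group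
  have h2 := congrArg (· ^ f) h1
  simp only [conj_pow, hc.mul_pow] at h2
  have h3 : y ^ f * x = x * y ^ f := A.ker _ (by rw [map_pow, hf]) x
  rw [← h3] at h2
  simpa using h2

theorem pow_formula {M : Type*} [Group M] {u w c : M} (hu : Commute c u) (hw : Commute c w)
    (h : w * u = c * (u * w)) (n : ℕ) : (u * w) ^ n = c ^ (n.choose 2) * (u ^ n * w ^ n) := by
  have h1 : ∀ n : ℕ, w ^ n * u = c ^ n * (u * w ^ n) := by
    intro n
    induction n with
    | zero => simp
    | succ n ih =>
      rw [pow_succ, mul_assoc, h, ← mul_assoc, ← (hw.pow_right n).eq, mul_assoc,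
        ← mul_assoc (w ^ n), ih, pow_succ']
      simp only [mul_assoc]
  induction n with
  | zero => simp
  | succ n ih =>
    have h2 := (hu.pow_pow n n).eq
    calc (u * w) ^ (n + 1) = c ^ (n.choose 2) * (u ^ n * (w ^ n * u) * w) := by
          rw [pow_succ, ih]; simp only [mul_assoc]
      _ = c ^ (n.choose 2) * ((u ^ n * c ^ n) * u * w ^ n * w) := by
          rw [h1]; simp only [mul_assoc]
      _ = (c ^ (n.choose 2) * c ^ n) * (u ^ (n + 1) * w ^ (n + 1)) := by
          rw [← h2, pow_succ, pow_succ]; simp only [mul_assoc]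
      _ = _ := by
          rw [← pow_add, Nat.choose_succ_succ' n 1, Nat.choose_one_right, add_comm]

theorem lemE (A : AuxData Γ π ζ e) {x v : Γ} {f : ℕ} (h : Commute (π v) (π x * π v * (π x)⁻¹))
    (hf : π v ^ f = 1) : (∀ z, Commute ⁅v⁻¹, x * v * x⁻¹⁆ z) ∧ ⁅v⁻¹, x * v * x⁻¹⁆ ^ f = 1 ∧
    (x * v * x⁻¹ * v⁻¹) ^ f = ⁅v⁻¹, x * v * x⁻¹⁆ ^ (f.choose 2) := by
  have h' : Commute (π v⁻¹) (π (x * v * x⁻¹)) := by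
    simpa only [map_inv, map_mul] using h.inv_left
  have h1 : ∀ z, Commute ⁅v⁻¹, x * v * x⁻¹⁆ z := by
    apply A.ker
    rw [map_commutatorElement, commutatorElement_eq_one_iff_mul_comm]
    exact h'
  refine ⟨h1, A.comm_root' h' ?_, ?_⟩
  · simp [map_mul, conj_pow, hf]
  · rw [pow_formula (c := ⁅v⁻¹, x * v * x⁻¹⁆) (h1 _) (h1 _)
      (by rw [commutatorElement_def]; group)]
    have h3 : v ^ f * x = x * v ^ f := A.ker _ (by rw [map_pow, hf]) x
    rw [conj_pow, ← h3]
    simp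

theorem fix {q v : H} {f : ℕ} (hq : (orderOf q).Coprime f)
    (h1 : Commute (q * v * q⁻¹ * v⁻¹) q) (h3 : (q * v * q⁻¹ * v⁻¹) ^ f = 1) :
    q * v * q⁻¹ * v⁻¹ = 1 := by
  set w := q * v * q⁻¹ * v⁻¹ with hw
  have h : ∀ j : ℕ, q ^ j * v = w ^ j * v * q ^ j := by
    intro j
    induction j with
    | zero => simp
    | succ j ih =>
      have : q * v = w * v * q := by rw [hw]; group
      calc q ^ (j + 1) * v = q ^ j * (q * v) := by rw [pow_succ, mul_assoc]
        _ = w * (q ^ j * v) * q := by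
          rw [this]; simp only [← mul_assoc]; rw [(h1.pow_right j).eq]
        _ = _ := by rw [ih]; simp only [pow_succ, ← mul_assoc]; rw [← pow_succ', ← pow_succ]
  have h4 := h (orderOf q)
  rw [pow_orderOf_eq_one, one_mul, mul_one] at h4
  have h5 : w ^ orderOf q = 1 := by simpa using h4.symm
  rw [← orderOf_eq_one_iff]
  exact Nat.eq_one_of_dvd_coprimes hq (orderOf_dvd_of_pow_eq_one h5) (orderOf_dvd_of_pow_eq_one h3)

theorem quat [CharZero D] {i j : D} (hi : i * i = -1) (hj : j * j = -1) (hij : j * i = -(i * j)) :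
    ∃ w : D, w ^ 3 = 1 ∧ w * i ≠ i * w := by
  have h2 : (2 : D) ≠ 0 := two_ne_zero
  have c2 : ∀ x : D, (2 : D)⁻¹ * x = x * (2 : D)⁻¹ := fun x =>
    ((Commute.ofNat_left 2 x).inv_left₀).eq
  have a1 : ∀ x : D, i * (i * x) = -x := fun x => by rw [← mul_assoc, hi]; simp
  have a2 : ∀ x : D, j * (j * x) = -x := fun x => by rw [← mul_assoc, hj]; simp
  have a3 : ∀ x : D, j * (i * x) = -(i * (j * x)) := fun x => by
    rw [← mul_assoc, hij]; simp [mul_assoc]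
  have hsq : (-1 + i + j + i * j) * (-1 + i + j + i * j) = -(1 + 1) * (1 + i + j + i * j) := by
    simp only [mul_add, add_mul, mul_assoc, a1, a2, a3, hi, hj, hij, mul_neg, neg_mul, one_mul,
      mul_one, neg_add_rev]
    abel
  have hcu : (-1 + i + j + i * j) * ((-1 + i + j + i * j) * (-1 + i + j + i * j)) = 8 := by
    rw [hsq]
    have h8 : (8 : D) = 1 + 1 + 1 + 1 + 1 + 1 + 1 + 1 := by norm_num
    rw [h8]
    simp only [mul_add, add_mul, mul_assoc, a1, a2, a3, hi, hj, hij, mul_neg, neg_mul, one_mul,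
      mul_one, neg_add_rev, neg_neg]
    abel
  refine ⟨2⁻¹ * (-1 + i + j + i * j), ?_, ?_⟩
  · have : (2⁻¹ * (-1 + i + j + i * j)) ^ 3 = (2⁻¹) ^ 3 * (-1 + i + j + i * j) ^ 3 :=
      Commute.mul_pow (c2 _) 3
    rw [this, pow_succ' (-1 + i + j + i * j), pow_two, hcu]
    norm_num
  · intro h
    rw [← mul_assoc, ← c2 i, mul_assoc, mul_assoc] at h
    have h := mul_left_cancel₀ (inv_ne_zero h2) h
    simp only [mul_add, add_mul, mul_assoc, a1, a2, a3, hi, hj, hij, mul_neg, neg_mul, one_mul,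
      mul_one] at h
    have h6 : 2 * j = 2 * (i * j) := by
      rw [two_mul, two_mul, ← sub_eq_zero]
      rw [← sub_eq_zero] at h
      rw [← h]; abel
    have h7 := mul_left_cancel₀ h2 h6
    have hj0 : j ≠ 0 := by rintro rfl; simp at hj
    have : i = 1 := by
      apply mul_right_cancel₀ hj0; rw [one_mul]; exact h7.symm
    rw [this] at hi
    have : (2 : D) = 0 := by rw [← one_add_one_eq_two]; nth_rewrite 2 [← mul_one 1]; rw [hi]; simp
    exact h2 this


theorem pm (A : AuxData Γ π ζ e) {a b : Γ}
    (h : ((a : Dˣ) : D) = ((b : Dˣ) : D) ∨ ((a : Dˣ) : D) = -((b : Dˣ) : D)) : π a = π b := by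
  rw [← mul_inv_eq_one, ← map_inv, ← map_mul]
  apply A.cen
  intro d
  simp only [Subgroup.coe_mul, Subgroup.coe_inv, Units.val_mul, Units.val_inv_eq_inv_val]
  have hb : ((b : Dˣ) : D) ≠ 0 := Units.ne_zero _
  rcases h with h | h <;> rw [h] <;> simp

theorem sq_pm {a b : D} (hc : a * b = b * a) (h : a * a = b * b) : a = b ∨ a = -b := by
  have : (a - b) * (a + b) = 0 := by
    rw [sub_mul, mul_add, mul_add, h, hc]; abel
  rcases mul_eq_zero.1 this with h | h
  · exact Or.inl (sub_eq_zero.1 h)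
  · exact Or.inr (eq_neg_of_add_eq_zero_left h)

theorem sq_one_pm {a : D} (h : a ^ 2 = 1) : a = 1 ∨ a = -1 :=
  sq_pm (by simp) (by rw [← pow_two, h, one_mul])

theorem propB_aux [CharZero D] (A : AuxData Γ π ζ e) (P : Subgroup H)
    (hPc : ∀ a ∈ P, ∀ b ∈ P, a * b = b * a) (f : ℕ) (hfe : f ∣ e) (hf : ∀ u ∈ P, u ^ f = 1)
    (x v : Γ) (hxn : ∀ u ∈ P, π x * u * (π x)⁻¹ ∈ P) (hv : π v ∈ P)
    (hcop : (orderOf (π x)).Coprime f) (hcase : Odd f ∨ f = 2 ∨ 4 ∣ f) :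
    π x * π v * (π x)⁻¹ * (π v)⁻¹ = 1 := by
  have pow1 : ∀ w : Γ, w ^ f = 1 → π w = 1 := by
    intro w hw
    obtain ⟨m, rfl⟩ := hfe
    exact A.pi_one (by rw [pow_mul, hw, one_pow])
  by_contra hne
  set w := x * v * x⁻¹ * v⁻¹ with hw
  have hπw : π w = π x * π v * (π x)⁻¹ * (π v)⁻¹ := by simp [hw]
  have hwP : π w ∈ P := by
    rw [hπw]; exact P.mul_mem (hxn _ hv) (P.inv_mem hv)
  rw [← hπw] at hne
  obtain ⟨hc1, hc2, hc3⟩ := A.lemE (x := x) (v := v) (f := f) (hPc _ hv _ (hxn _ hv)) (hf _ hv)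
  rw [← hw] at hc3
  set c := ⁅v⁻¹, x * v * x⁻¹⁆
  have hnc : ¬ Commute (π w) (π x) := by
    intro h
    apply hne
    rw [hπw] at *
    exact fix hcop h (hf _ hwP)
  rcases hcase with hodd | hcase
  · apply hne
    apply pow1
    rw [hc3]
    obtain ⟨j, hj⟩ := hodd
    have : f.choose 2 = f * j := by
      rw [Nat.choose_two_right, hj, Nat.add_sub_cancel, mul_left_comm, Nat.mul_div_cancel_left _ two_pos]
    rw [this, pow_mul, hc2, one_pow]
  have hcC : (c ^ (f.choose 2)) ^ 2 = 1 := by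
    rw [← pow_mul, Nat.choose_two_right, Nat.div_mul_cancel (Nat.even_mul_pred_self f).two_dvd,
      pow_mul, hc2, one_pow]
  have hwf2 : (w ^ f) ^ 2 = 1 := by rw [hc3, hcC]
  have hwf : ((w : Dˣ) : D) ^ f = -1 := by
    have h1 := congrArg (fun z : Γ => ((z : Dˣ) : D)) hwf2
    have h2 : (((w : Dˣ) : D) ^ f) ^ 2 = 1 := by simpa using h1
    rcases sq_one_pm h2 with h3 | h3
    · exfalso
      apply hne
      apply pow1
      apply Subtype.ext; apply Units.ext
      simpa using h3
    · exact h3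
  have hw2 : (w ^ 2) ^ f = 1 := by rw [← pow_mul, mul_comm, pow_mul, hwf2]
  have hw2c : ∀ z : Γ, Commute (w ^ 2) z := A.ker _ (pow1 _ hw2)
  set w' := x * w * x⁻¹ with hw'
  have hπw' : π w' = π x * π w * (π x)⁻¹ := by simp [hw']
  have hw'P : π w' ∈ P := by rw [hπw']; exact hxn _ hwP
  obtain ⟨hd1, hd2, hd3⟩ := A.lemE (x := x) (v := w) (f := f) (hPc _ hwP _ (hxn _ hwP)) (hf _ hwP)
  rw [← hw'] at hd1 hd2 hd3
  set d := ⁅w⁻¹, w'⁆ with hd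
  have hs : π (w' * w⁻¹) ≠ 1 := by
    intro h
    apply hnc
    rw [map_mul, map_inv, mul_inv_eq_one, hπw', mul_inv_eq_iff_eq_mul] at h
    exact h.symm
  have hd1' : d ≠ 1 := by
    intro h
    apply hnc
    have : Commute w w' := by
      have h1 : Commute w⁻¹ w' := commutatorElement_eq_one_iff_mul_comm.1 h
      exact Commute.inv_left_iff.1 h1
    exact (A.star this).symm
  have hconj : w⁻¹ * w' * w = d * w' := by rw [hd, commutatorElement_def]; group
  have hdsq : d ^ 2 = 1 := by
    have h1 : (w ^ 2)⁻¹ * w' * w ^ 2 = d ^ 2 * w' := by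
      calc (w ^ 2)⁻¹ * w' * w ^ 2 = w⁻¹ * (w⁻¹ * w' * w) * w := by simp [pow_succ, mul_assoc]
        _ = w⁻¹ * d * (w' * w) := by rw [hconj]; group
        _ = d * (w⁻¹ * w' * w) := by rw [← (hd1 w⁻¹).eq]; group
        _ = d ^ 2 * w' := by rw [hconj, pow_two, mul_assoc]
    have h2 : (w ^ 2)⁻¹ * w' * w ^ 2 = w' := by
      rw [mul_assoc, ← (hw2c w').eq, inv_mul_cancel_left]
    rw [h2] at h1
    simpa using h1.symm
  have hdD : ((d : Dˣ) : D) = -1 := by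
    have h1 := congrArg (fun z : Γ => ((z : Dˣ) : D)) hdsq
    have h2 : ((d : Dˣ) : D) ^ 2 = 1 := by simpa using h1
    rcases sq_one_pm h2 with h3 | h3
    · exfalso
      apply hd1'
      apply Subtype.ext; apply Units.ext
      simpa using h3
    · exact h3
  rcases hcase with rfl | h4
  swap
  · apply hs
    apply pow1
    rw [hd3]
    obtain ⟨j, rfl⟩ := h4
    have : (4 * j).choose 2 = 2 * (j * (4 * j - 1)) := by
      rw [Nat.choose_two_right]
      apply Nat.div_eq_of_eq_mul_left two_pos
      ring
    rw [this, pow_mul, hdsq, one_pow]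
  -- quaternion case
  have hwP' : π w * π w = 1 := by rw [← pow_two]; exact hf _ hwP
  have hw'P' : π w' * π w' = 1 := by rw [← pow_two]; exact hf _ hw'P
  set w'' := x * w' * x⁻¹ with hw''
  have hπw'' : π w'' = π x * π w' * (π x)⁻¹ := by simp [hw'']
  have hw''P : π w'' ∈ P := by rw [hπw'']; exact hxn _ hw'P
  have I1 : ((w : Dˣ) : D) * ((w : Dˣ) : D) = -1 := by rw [← pow_two]; exact hwf
  have X0 : ((x : Dˣ) : D) ≠ 0 := Units.ne_zero _
  have e1 : ((w' : Dˣ) : D) = ((x : Dˣ) : D) * ((w : Dˣ) : D) * ((x : Dˣ) : D)⁻¹ := by simp [hw']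
  have e2 : ((w'' : Dˣ) : D) = ((x : Dˣ) : D) * ((w' : Dˣ) : D) * ((x : Dˣ) : D)⁻¹ := by simp [hw'']
  have cj : ∀ (X a b : D), X ≠ 0 → (X * a * X⁻¹) * (X * b * X⁻¹) = X * (a * b) * X⁻¹ := by
    intro X a b hX
    simp only [mul_assoc]
    rw [inv_mul_cancel_left₀ hX]
  have I2 : ((w' : Dˣ) : D) * ((w' : Dˣ) : D) = -1 := by
    rw [e1, cj _ _ _ X0, I1]; simp [X0]
  have I3 : ((w'' : Dˣ) : D) * ((w'' : Dˣ) : D) = -1 := by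
    rw [e2, cj _ _ _ X0, I2]; simp [X0]
  have J1 : ((w' : Dˣ) : D) * ((w : Dˣ) : D) = -(((w : Dˣ) : D) * ((w' : Dˣ) : D)) := by
    have h1 : w' * w = d * (w * w') := by
      have : w' * w = w * (w⁻¹ * w' * w) := by group
      rw [this, hconj, ← mul_assoc, ← (hd1 w).eq, mul_assoc]
    have h2 := congrArg (fun z : Γ => ((z : Dˣ) : D)) h1
    simpa [hdD] using h2
  have J2 : ((w'' : Dˣ) : D) * ((w' : Dˣ) : D) = -(((w' : Dˣ) : D) * ((w'' : Dˣ) : D)) := by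
    have : ((w'' : Dˣ) : D) * ((w' : Dˣ) : D) =
      ((x : Dˣ) : D) * (((w' : Dˣ) : D) * ((w : Dˣ) : D)) * ((x : Dˣ) : D)⁻¹ := by
      rw [e2]; nth_rewrite 2 [e1]; rw [cj _ _ _ X0]
    rw [this, J1, mul_neg, neg_mul, ← cj _ _ _ X0, ← e1, ← e2]
  by_cases h3e : 3 ∣ e
  · obtain ⟨ω, hω, hωi⟩ := quat I1 I2 J1
    apply hωi
    apply A.root_cen
    obtain ⟨m, rfl⟩ := h3e
    rw [pow_mul, hω, one_pow]
  have h3o : (3 : ℕ).Coprime (orderOf (π x)) := by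
    rw [Nat.Prime.coprime_iff_not_dvd Nat.prime_three]
    intro h
    exact h3e (h.trans (orderOf_dvd_of_pow_eq_one (A.exp _)))
  apply hnc
  have hlast : Commute (π w) (π x ^ orderOf (π x)) := by
    rw [pow_orderOf_eq_one]; exact Commute.one_right _
  have hcases : ((w'' : Dˣ) : D) * ((w : Dˣ) : D) = ((w : Dˣ) : D) * ((w'' : Dˣ) : D) ∨
      ((w'' : Dˣ) : D) * ((w : Dˣ) : D) = -(((w : Dˣ) : D) * ((w'' : Dˣ) : D)) := by
    have h1 := A.comm_root' (x := w'') (y := w) (hPc _ hw''P _ hwP) (f := 2) (hf _ hwP)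
    have h2 : w'' * w = ⁅w'', w⁆ * (w * w'') := by rw [commutatorElement_def]; group
    have h3 : (((⁅w'', w⁆ : Γ) : Dˣ) : D) ^ 2 = 1 := by
      have h4 := congrArg (fun z : Γ => ((z : Dˣ) : D)) h1
      simpa using h4
    have h5 : ((w'' : Dˣ) : D) * ((w : Dˣ) : D) =
        (((⁅w'', w⁆ : Γ) : Dˣ) : D) * (((w : Dˣ) : D) * ((w'' : Dˣ) : D)) := by
      have h4 := congrArg (fun z : Γ => ((z : Dˣ) : D)) h2
      simpa using h4
    rcases sq_one_pm h3 with h6 | h6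
    · left; rw [h5, h6, one_mul]
    · right; rw [h5, h6, neg_one_mul]
  rcases hcases with h | h
  · have h1 := A.pm (sq_pm h (by rw [I1, I3]))
    have h2 : Commute (π w) (π x ^ 2) := by
      rw [hπw'', hπw'] at h1
      have : π x ^ 2 * π w = π x * (π x * π w * (π x)⁻¹) * (π x)⁻¹ * π x ^ 2 := by
        simp [pow_succ, mul_assoc]
      rw [h1] at this
      exact this.symm
    exact aux_commute_of_coprime_pow (Nat.Coprime.symm hcop) h2 hlast
  · have hcm : ((w'' : Dˣ) : D) * (((w : Dˣ) : D) * ((w' : Dˣ) : D)) =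
        (((w : Dˣ) : D) * ((w' : Dˣ) : D)) * ((w'' : Dˣ) : D) := by
      rw [← mul_assoc, h, neg_mul, mul_assoc, J2, mul_neg, neg_neg, mul_assoc]
    have hsq : (((w : Dˣ) : D) * ((w' : Dˣ) : D)) * (((w : Dˣ) : D) * ((w' : Dˣ) : D)) = -1 := by
      rw [mul_assoc, ← mul_assoc ((w' : Dˣ) : D), J1, neg_mul, mul_neg, mul_assoc, I2, ← mul_assoc, I1]
      simp
    have h1 : π w'' = π (w * w') := by
      apply A.pm
      have := sq_pm hcm (by rw [hsq, I3])
      simpa using this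
    have h2 : Commute (π w) (π x ^ 3) := by
      have h3 : π x * π w'' * (π x)⁻¹ = π w := by
        calc π x * π w'' * (π x)⁻¹ = (π x * π w * (π x)⁻¹) * (π x * π w' * (π x)⁻¹) := by
              rw [h1, map_mul]; group
          _ = π w' * (π w * π w') := by rw [← hπw', ← hπw'', h1, map_mul π w w']
          _ = π w' * π w' * π w := by rw [hPc _ hwP _ hw'P, mul_assoc]
          _ = π w := by rw [hw'P', one_mul]
      have : π x ^ 3 * π w = (π x * π w'' * (π x)⁻¹) * π x ^ 3 := by
        rw [hπw'', hπw']; simp [pow_succ, mul_assoc]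
      rw [h3] at this
      exact this.symm
    exact aux_commute_of_coprime_pow h3o h2 hlast

theorem propB [CharZero D] [Finite H] (A : AuxData Γ π ζ e) (p : ℕ) (hp : p.Prime)
    (P : Subgroup H) (hP : IsPGroup p P) (hPc : ∀ a ∈ P, ∀ b ∈ P, a * b = b * a) (q : H)
    (hq : q ∈ Subgroup.normalizer (P : Set H)) (hcop : (orderOf q).Coprime p) (a : H)
    (ha : a ∈ P) : Commute a q := by
  have : Fact p.Prime := ⟨hp⟩
  obtain ⟨n, hn⟩ := IsPGroup.iff_card.1 hP
  obtain ⟨k, -, hk⟩ := (Nat.dvd_prime_pow hp).1 (hn ▸ Group.exponent_dvd_nat_card (G := P))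
  obtain ⟨x, rfl⟩ := A.surj q
  obtain ⟨v, rfl⟩ := A.surj a
  have := A.propB_aux P hPc (p ^ k) (by
      rw [← hk]
      apply Monoid.exponent_dvd_of_forall_pow_eq_one
      intro g
      exact Subtype.ext (by simpa using A.exp g)) (by
      intro u hu
      rw [← hk]
      simpa using congrArg Subtype.val (Monoid.pow_exponent_eq_one (⟨u, hu⟩ : P))) x v
      (fun u hu => (Subgroup.mem_normalizer_iff.1 hq u).1 hu) ha (hcop.pow_right k) (by
      rcases hp.eq_two_or_odd' with rfl | h
      · rcases k with _ | _ | k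
        · left; simp
        · right; left; simp
        · right; right; exact ⟨2 ^ k, by ring⟩
      · left; exact h.pow)
  rw [mul_inv_eq_one, mul_inv_eq_iff_eq_mul] at this
  exact this.symm

theorem comm [CharZero D] [Finite H] (A : AuxData Γ π ζ e) (a b : H) : a * b = b * a :=
  aux_comm_of_props A.propA A.propB a b

end AuxData

theorem aux_symp {F : Type*} [Field F] (m : ℕ) : ∀ (H : Type*) [CommGroup H] [Finite H]
    (_ : Nat.card H = m) (β : H →* H →* Fˣ) (_ : ∀ x, β x x = 1)
    (_ : ∀ x, (∀ y, β x y = 1) → x = 1),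
    ∃ (A : Type) (_ : CommGroup A) (_ : Finite A), Nonempty (H ≃* A × A) := by
  induction m using Nat.strong_induction_on with
  | _ m ih =>
  intro H _ _ hm β halt hnd
  rcases subsingleton_or_nontrivial H with hs | hs
  · refine ⟨Unit, inferInstance, inferInstance, ⟨?_⟩⟩
    exact { toFun := fun _ => 1, invFun := fun _ => 1,
            left_inv := fun _ => Subsingleton.elim _ _,
            right_inv := fun _ => Subsingleton.elim _ _,
            map_mul' := fun _ _ => Subsingleton.elim _ _ }
  obtain ⟨g, hg⟩ := Monoid.exists_orderOf_eq_exponent (G := H) Monoid.ExponentExists.of_finite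
  set n := Monoid.exponent H with hn
  have hn0 : 0 < n := Monoid.exponent_pos.2 Monoid.ExponentExists.of_finite
  have hskew : ∀ x y, β x y = (β y x)⁻¹ := by
    intro x y
    have := halt (x * y)
    simp only [map_mul, MonoidHom.mul_apply, halt, one_mul, mul_one] at this
    rw [eq_inv_iff_mul_eq_one, mul_comm]; exact this
  have hpow : ∀ x : H, x ^ n = 1 := Monoid.pow_exponent_eq_one
  have hβn : ∀ x y, β x y ^ n = 1 := fun x y => by rw [← map_pow, hpow, map_one]
  have : Finite (β g).range :=
    Finite.of_surjective (β g).rangeRestrict (β g).rangeRestrict_surjective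
  obtain ⟨⟨ω, h, hω⟩, hgen⟩ := IsCyclic.exists_generator (α := (β g).range)
  have hωo : orderOf ω = n := by
    apply Nat.dvd_antisymm
    · apply orderOf_dvd_of_pow_eq_one; rw [← hω]; exact hβn _ _
    · rw [← hg]
      apply orderOf_dvd_of_pow_eq_one
      apply hnd
      intro y
      obtain ⟨k, hk⟩ := hgen ⟨β g y, y, rfl⟩
      have hk' : ω ^ k = β g y := congrArg Subtype.val hk
      rw [map_pow, MonoidHom.pow_apply, ← hk', ← zpow_natCast, ← zpow_mul, mul_comm, zpow_mul,
        zpow_natCast, pow_orderOf_eq_one, one_zpow]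
  have hroot : ∀ u : Fˣ, u ^ n = 1 → ∃ k : ℤ, ω ^ k = u := by
    intro u hu
    have : NeZero n := ⟨hn0.ne'⟩
    have hp : IsPrimitiveRoot ω n := hωo ▸ IsPrimitiveRoot.orderOf ω
    have : u ∈ Subgroup.zpowers ω := by
      rw [hp.zpowers_eq]
      exact hu
    exact this
  have hzω : ∀ k : ℤ, ω ^ k = 1 ↔ (n : ℤ) ∣ k := fun k => by
    rw [← hωo, orderOf_dvd_iff_zpow_eq_one]
  have hzH : ∀ (x : H) (k : ℤ), (n : ℤ) ∣ k → x ^ k = 1 := by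
    rintro x k ⟨j, rfl⟩
    rw [zpow_mul, zpow_natCast, hpow, one_zpow]
  have hho : orderOf h = n := by
    apply Nat.dvd_antisymm (orderOf_dvd_of_pow_eq_one (hpow h))
    rw [← hωo]
    apply orderOf_dvd_of_pow_eq_one
    rw [← hω, ← map_pow, pow_orderOf_eq_one, map_one]
  let T : Subgroup H := (β g).ker ⊓ (β h).ker
  let βT : T →* T →* Fˣ := MonoidHom.mk' (fun t => (β t).comp T.subtype) (by
    intro a b; ext; simp)
  have hTlt : Nat.card T < m := by
    rw [← hm]
    refine lt_of_le_of_ne (Subgroup.card_le_card_group T) ?_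
    intro heq
    have hT : T = ⊤ := Subgroup.eq_top_of_card_eq T heq
    have h1 : h ∈ T := hT ▸ Subgroup.mem_top h
    have h2 : β g h = 1 := h1.1
    rw [hω] at h2
    rw [h2, orderOf_one] at hωo
    have : Subsingleton H := Monoid.exp_eq_one_iff.1 hωo.symm
    exact not_subsingleton H this
  let μ : T × (Subgroup.zpowers g × Subgroup.zpowers h) →* H :=
    T.subtype.coprod ((Subgroup.zpowers g).subtype.coprod (Subgroup.zpowers h).subtype)
  have hμ : ∀ t a b, μ (t, a, b) = t * (a * b) := fun t a b => rfl
  have hμi : Function.Injective μ := by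
    rw [injective_iff_map_eq_one]
    rintro ⟨⟨t, ht1, ht2⟩, ⟨_, a, rfl⟩, ⟨_, b, rfl⟩⟩ hx
    have hx' : t * (g ^ a * h ^ b) = 1 := hx
    have ht1' : β g t = 1 := ht1
    have ht2' : β h t = 1 := ht2
    have h1 := congrArg (β g) hx'
    have h2 := congrArg (β h) hx'
    simp only [map_mul, map_zpow, ht1', ht2', halt, one_zpow, hω, one_mul, mul_one, map_one] at h1 h2
    rw [hskew, hω, inv_zpow, inv_eq_one, hzω] at h2
    rw [hzω] at h1
    have ha := hzH g a h2
    have hb := hzH h b h1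
    rw [ha, hb, one_mul, mul_one] at hx'
    ext <;> simp [ha, hb, hx']
  have hμs : Function.Surjective μ := by
    intro x
    obtain ⟨b, hb⟩ := hroot (β g x) (hβn _ _)
    obtain ⟨a, ha⟩ := hroot (β x h) (hβn _ _)
    refine ⟨(⟨x * (g ^ a * h ^ b)⁻¹, ?_, ?_⟩, ⟨g ^ a, a, rfl⟩, ⟨h ^ b, b, rfl⟩), ?_⟩
    · change β g _ = 1
      simp [map_mul, map_zpow, halt, hω, hb]
    · change β h _ = 1
      rw [map_mul, map_inv, map_mul, map_zpow, map_zpow, halt, hskew h x, hskew h g, hω, ← ha]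
      simp
    · rw [hμ]; exact inv_mul_cancel_right x _
  obtain ⟨A, _, _, ⟨E⟩⟩ := ih _ hTlt T rfl βT (fun x => halt x) (by
    rintro ⟨x, hx1, hx2⟩ hx
    apply Subtype.ext
    apply hnd
    intro y
    obtain ⟨⟨t, ⟨_, a, rfl⟩, ⟨_, b, rfl⟩⟩, rfl⟩ := hμs y
    have h1 : β x t = 1 := hx t
    have hx1' : β g x = 1 := hx1
    have hx2' : β h x = 1 := hx2
    rw [hμ]
    have hx3 : β x g = 1 := by rw [hskew, hx1', inv_one]
    have hx4 : β x h = 1 := by rw [hskew, hx2', inv_one]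
    simp [map_mul, h1, hx3, hx4])
  have : NeZero n := ⟨hn0.ne'⟩
  have c1 : Subgroup.zpowers g ≃* Multiplicative (ZMod n) :=
    mulEquivOfCyclicCardEq (by rw [Nat.card_zpowers, hg]; simp)
  have c2 : Subgroup.zpowers h ≃* Multiplicative (ZMod n) :=
    mulEquivOfCyclicCardEq (by rw [Nat.card_zpowers, hho]; simp)
  refine ⟨A × Multiplicative (ZMod n), inferInstance, inferInstance, ⟨?_⟩⟩
  exact (MulEquiv.ofBijective μ ⟨hμi, hμs⟩).symm.trans
    ((E.prodCongr (c1.prodCongr c2)).trans (MulEquiv.prodProdProdComm _ _ _ _))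

theorem aux_AW {E : Type*} [DivisionRing E] {ι : Type*} (b : ι → E)
    (hb : LinearIndependent (Subring.center E) b) (s : Finset ι) :
    ∀ a : ι → E, (∀ x, ∑ i ∈ s, a i * x * b i = 0) → ∀ i ∈ s, a i = 0 := by
  classical
  induction s using Finset.induction_on with
  | empty => simp
  | insert j s hj ih =>
    intro a ha
    by_cases h0 : a j = 0
    · have := ih a (fun x => by
        have := ha x
        rwa [Finset.sum_insert hj, h0, zero_mul, zero_mul, zero_add] at this)
      intro i hi
      rcases Finset.mem_insert.1 hi with rfl | hi
      · exact h0
      · exact this i hi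
    exfalso
    have h1 : ∀ x, x * b j + ∑ i ∈ s, ((a j)⁻¹ * a i) * x * b i = 0 := by
      intro x
      have := congrArg (fun t => (a j)⁻¹ * t) (ha x)
      simp only [mul_zero, Finset.sum_insert hj, mul_add, Finset.mul_sum, ← mul_assoc,
        inv_mul_cancel₀ h0, one_mul] at this
      exact this
    have h2 : ∀ y, ∀ i ∈ s, (a j)⁻¹ * a i * y - y * ((a j)⁻¹ * a i) = 0 := by
      intro y
      apply ih
      intro x
      have e1 := h1 (y * x)
      have e2 := congrArg (fun t => y * t) (h1 x)
      simp only [mul_zero, mul_add, Finset.mul_sum] at e2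
      simp only [sub_mul, Finset.sum_sub_distrib]
      have : ∑ i ∈ s, (a j)⁻¹ * a i * (y * x) * b i
        = ∑ i ∈ s, y * ((a j)⁻¹ * a i * x * b i) := by
        have e3 : y * x * b j = y * (x * b j) := mul_assoc _ _ _
        rw [e3] at e1
        exact add_left_cancel (e1.trans e2.symm)
      rw [sub_eq_zero]
      simpa only [mul_assoc] using this
    have hc : ∀ i ∈ s, (a j)⁻¹ * a i ∈ Subring.center E := by
      intro i hi
      rw [Subring.mem_center_iff]
      intro y
      exact (sub_eq_zero.1 (h2 y i hi)).symm
    rw [linearIndependent_iff'] at hb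
    have := hb (insert j s) (fun i => if h : i ∈ s then ⟨(a j)⁻¹ * a i, hc i h⟩ else 1) (by
      rw [Finset.sum_insert hj, dif_neg hj, one_smul]
      have := h1 1
      rw [one_mul] at this
      rw [← this]
      congr 1
      apply Finset.sum_congr rfl
      intro i hi
      rw [dif_pos hi, mul_one]
      rfl) j (Finset.mem_insert_self _ _)
    simp [hj] at this

theorem aux_END {E : Type*} [DivisionRing E] [Module.Finite (Subring.center E) E] :
    ∃ (ι : Type) (_ : Fintype ι) (b : ι → E), LinearIndependent (Subring.center E) b ∧
     ∀ f : E →ₗ[Subring.center E] E, ∃ a : ι → E, ∀ x, f x = ∑ i, a i * x * b i := by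
  classical
  let F := Subring.center E
  let b := Module.finBasis (Subring.center E) E
  refine ⟨_, inferInstance, b, b.linearIndependent, ?_⟩
  have hcc : ∀ (c : Subring.center E) (x : E), x * (c : E) = c * x := fun c x =>
    (Subring.mem_center_iff.1 c.2 x)
  have hsm : ∀ (c : Subring.center E) (x : E), c • x = (c : E) * x := fun c x => rfl
  let Φ : (Fin (Module.finrank (Subring.center E) E) → E) →ₗ[Subring.center E]
      (E →ₗ[Subring.center E] E) :=
    { toFun := fun a =>
        { toFun := fun x => ∑ i, a i * x * b i
          map_add' := fun x y => by simp [mul_add, add_mul, Finset.sum_add_distrib]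
          map_smul' := fun c x => by
            simp only [hsm, Finset.mul_sum, RingHom.id_apply]
            refine Finset.sum_congr rfl fun i _ => ?_
            rw [← mul_assoc (a i), hcc, mul_assoc, mul_assoc, mul_assoc] }
      map_add' := fun x y => by ext; simp [add_mul, Finset.sum_add_distrib]
      map_smul' := fun c x => by
        ext y
        simp only [hsm, Pi.smul_apply, LinearMap.coe_mk, AddHom.coe_mk, LinearMap.smul_apply,
          RingHom.id_apply, Finset.mul_sum, mul_assoc] }
  have hi : Function.Injective Φ := by
    rw [injective_iff_map_eq_zero]
    intro a ha
    funext i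
    exact aux_AW b b.linearIndependent Finset.univ a (fun x => LinearMap.congr_fun ha x) i
      (Finset.mem_univ i)
  have hs : Function.Surjective Φ := by
    refine (LinearMap.injective_iff_surjective_of_finrank_eq_finrank ?_).1 hi
    rw [Module.finrank_linearMap]
    simp [Module.finrank_pi_fintype]
  intro f
  obtain ⟨a, ha⟩ := hs f
  exact ⟨a, fun x => by rw [← ha]; rfl⟩

theorem aux_SN {E : Type*} [DivisionRing E] [Module.Finite (Subring.center E) E]
    (σ : E → E) (h1 : σ 1 = 1) (hadd : ∀ x y, σ (x + y) = σ x + σ y)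
    (hmul : ∀ x y, σ (x * y) = σ x * σ y)
    (hz : ∀ c ∈ Subring.center E, σ c = c) : ∃ d : E, d ≠ 0 ∧ ∀ x, d * x = σ x * d := by
  obtain ⟨ι, _, b, hb, hE⟩ := aux_END (E := E)
  obtain ⟨a, ha⟩ := hE
    { toFun := σ
      map_add' := hadd
      map_smul' := fun c x => by
        change σ ((c : E) * x) = (c : E) * σ x
        rw [hmul, hz c c.2] }
  replace ha : ∀ x, σ x = ∑ i, a i * x * b i := ha
  have hai : ∀ x i, a i * x - σ x * a i = 0 := by
    intro x i
    refine aux_AW b hb Finset.univ (fun i => a i * x - σ x * a i) (fun y => ?_) i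
      (Finset.mem_univ i)
    have := hmul x y
    rw [ha (x * y), ha y, Finset.mul_sum] at this
    simp only [sub_mul, Finset.sum_sub_distrib]
    rw [sub_eq_zero]
    simpa only [mul_assoc] using this
  by_contra hcon
  push Not at hcon
  have ha0 : ∀ i, a i = 0 := by
    intro i
    by_contra h0
    obtain ⟨x, hx⟩ := hcon (a i) h0
    exact hx (sub_eq_zero.1 (hai x i))
  have := ha 1
  rw [h1] at this
  simp [ha0] at this

theorem aux_DC {E : Type*} [DivisionRing E] [Module.Finite (Subring.center E) E]
    (L : Subfield E) (hL : ∀ c ∈ Subring.center E, c ∈ L) (z : E)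
    (hz : ∀ y : E, (∀ l ∈ L, y * l = l * y) → z * y = y * z) : z ∈ L := by
  by_contra hzL
  have hz1 : z ∉ Submodule.span L {(1 : E)} := by
    intro h
    obtain ⟨l, rfl⟩ := Submodule.mem_span_singleton.1 h
    apply hzL
    have : l • (1 : E) = (l : E) := mul_one (l : E)
    rw [this]; exact l.2
  obtain ⟨g, hg1, hg2⟩ := Submodule.exists_le_ker_of_notMem hz1
  have hg1' : g 1 = 0 := hg2 (Submodule.subset_span rfl)
  have hgl : ∀ (l : E) (hl : l ∈ L) (x : E), (g (l * x) : E) = l * g x := by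
    intro l hl x
    have := g.map_smul ⟨l, hl⟩ x
    exact congrArg Subtype.val this
  obtain ⟨ι, _, b, hb, hE⟩ := aux_END (E := E)
  obtain ⟨a, ha⟩ := hE
    { toFun := fun x => (g x : E)
      map_add' := fun x y => by simp
      map_smul' := fun c x => hgl c (hL c c.2) x }
  replace ha : ∀ x, (g x : E) = ∑ i, a i * x * b i := ha
  have hai : ∀ l ∈ L, ∀ i, a i * l = l * a i := by
    intro l hl i
    have := aux_AW b hb Finset.univ (fun i => a i * l - l * a i) (fun y => ?_) i
      (Finset.mem_univ i)
    · exact sub_eq_zero.1 this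
    have := hgl l hl y
    rw [ha (l * y), ha y, Finset.mul_sum] at this
    simp only [sub_mul, Finset.sum_sub_distrib]
    rw [sub_eq_zero]
    simpa only [mul_assoc] using this
  apply hg1
  apply Subtype.ext
  rw [ha z]
  have h1 := ha 1
  rw [hg1'] at h1
  have : ∑ i, a i * z * b i = z * ∑ i, a i * 1 * b i := by
    rw [Finset.mul_sum]
    refine Finset.sum_congr rfl fun i _ => ?_
    rw [← hz (a i) (fun l hl => hai l hl i), mul_one, mul_assoc]
  rw [this, ← h1]
  simp

theorem aux_uniq [Fintype G] {𝒜 : G → AddSubgroup D} (hG : IsFaithfulGrading 𝒜) (c : G → D)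
    (hc : ∀ g, c g ∈ 𝒜 g) (h0 : ∑ g, c g = 0) (g : G) : c g = 0 := by
  have hi := hG.isInternal.1
  rw [injective_iff_map_eq_zero] at hi
  have := hi (∑ g, DirectSum.of (fun g => 𝒜 g) g ⟨c g, hc g⟩) (by
    rw [map_sum]
    simpa [DirectSum.coeAddMonoidHom_of] using h0)
  have h2 := congrArg (fun t => ((t g : 𝒜 g) : D)) this
  simpa [DFinsupp.finsetSum_apply, DirectSum.sum_apply, DirectSum.of_apply, Finset.sum_apply,
    apply_dite, Finset.sum_dite_eq] using h2

theorem aux_dec [Fintype G] {𝒜 : G → AddSubgroup D} (hG : IsFaithfulGrading 𝒜) (x : D) :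
    ∃ c : G → D, (∀ g, c g ∈ 𝒜 g) ∧ x = ∑ g, c g := by
  obtain ⟨y, rfl⟩ := hG.isInternal.2 x
  induction y using DirectSum.induction_on with
  | zero => exact ⟨fun _ => 0, fun g => (𝒜 g).zero_mem, by simp⟩
  | of i x =>
    refine ⟨fun g => if g = i then x else 0, fun g => ?_, ?_⟩
    · dsimp only
      split_ifs with h
      · subst h; exact x.2
      · exact (𝒜 g).zero_mem
    · simp [DirectSum.coeAddMonoidHom_of]
  | add x y hx hy =>
    obtain ⟨c, hc, h1⟩ := hx
    obtain ⟨d, hd, h2⟩ := hy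
    exact ⟨fun g => c g + d g, fun g => (𝒜 g).add_mem (hc g) (hd g), by
      rw [map_add, h1, h2, Finset.sum_add_distrib]⟩

theorem aux_uniq' [Fintype G] {𝒜 : G → AddSubgroup D} (hG : IsFaithfulGrading 𝒜) (c d : G → D)
    (hc : ∀ g, c g ∈ 𝒜 g) (hd : ∀ g, d g ∈ 𝒜 g) (h0 : ∑ g, c g = ∑ g, d g) (g : G) :
    c g = d g := by
  rw [← sub_eq_zero]
  exact aux_uniq hG (fun g => c g - d g) (fun g => (𝒜 g).sub_mem (hc g) (hd g))
    (by rw [Finset.sum_sub_distrib, h0, sub_self]) g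

theorem aux_deg [Fintype G] {𝒜 : G → AddSubgroup D} (hG : IsFaithfulGrading 𝒜) {x : D} {g h : G}
    (hx : x ≠ 0) (hg : x ∈ 𝒜 g) (hh : x ∈ 𝒜 h) : g = h := by
  by_contra hgh
  have hm : ∀ i, x ∈ 𝒜 i → ∀ k, (if k = i then x else 0) ∈ 𝒜 k := by
    intro i hi k
    split_ifs with h
    · subst h; exact hi
    · exact (𝒜 k).zero_mem
  have := aux_uniq' hG (fun k => if k = g then x else 0) (fun k => if k = h then x else 0)
    (hm g hg) (hm h hh) (by simp) g
  simp [hgh] at this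
  exact hx this

theorem aux_inv [Fintype G] {𝒜 : G → AddSubgroup D} (hG : IsFaithfulGrading 𝒜) {x : D} {g : G}
    (hg : x ∈ 𝒜 g) : x⁻¹ ∈ 𝒜 g⁻¹ := by
  by_cases hx : x = 0
  · rw [hx, inv_zero]; exact (𝒜 _).zero_mem
  obtain ⟨c, hc, hs⟩ := aux_dec hG x⁻¹
  have h1 : x * c (g⁻¹ * 1) = if (1 : G) = 1 then 1 else 0 := by
    refine aux_uniq' hG (fun s => x * c (g⁻¹ * s)) (fun s => if s = 1 then 1 else 0) ?_ ?_ ?_ 1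
    · intro s
      have := hG.mul_mem hg (hc (g⁻¹ * s))
      rwa [mul_inv_cancel_left] at this
    · intro s
      split_ifs with h
      · subst h; exact hG.one_mem
      · exact (𝒜 s).zero_mem
    · rw [← Finset.mul_sum, Fintype.sum_equiv (Equiv.mulLeft g⁻¹) (fun s => c (g⁻¹ * s)) c
        (fun _ => rfl), ← hs, mul_inv_cancel₀ hx]
      simp
  rw [if_pos rfl, mul_one] at h1
  rw [inv_eq_of_mul_eq_one_right h1]
  exact hc _

/-- identity component as a sub-division-ring -/
def auxE [Fintype G] {𝒜 : G → AddSubgroup D} (hG : IsFaithfulGrading 𝒜) : Subfield D where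
  carrier := 𝒜 1
  mul_mem' := fun {a b} ha hb => by
    have := hG.mul_mem ha hb
    rwa [one_mul] at this
  one_mem' := hG.one_mem
  add_mem' := fun ha hb => (𝒜 1).add_mem ha hb
  zero_mem' := (𝒜 1).zero_mem
  neg_mem' := fun ha => (𝒜 1).neg_mem ha
  inv_mem' := fun x hx => by
    have := aux_inv hG hx
    rwa [inv_one] at this

theorem mem_auxE [Fintype G] {𝒜 : G → AddSubgroup D} (hG : IsFaithfulGrading 𝒜) (x : D) :
    x ∈ auxE hG ↔ x ∈ 𝒜 1 := Iff.rfl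

/-- `L` as a subfield -/
def auxL [Fintype G] {𝒜 : G → AddSubgroup D} (hG : IsFaithfulGrading 𝒜) : Subfield D where
  carrier := Lset 𝒜
  mul_mem' := fun {a b} ha hb => ⟨(auxE hG).mul_mem ha.1 hb.1, fun y hy => by
    rw [mul_assoc, hb.2 y hy, ← mul_assoc, ha.2 y hy, mul_assoc]⟩
  one_mem' := ⟨hG.one_mem, fun y _ => by simp⟩
  add_mem' := fun ha hb => ⟨(𝒜 1).add_mem ha.1 hb.1, fun y hy => by
    rw [add_mul, mul_add, ha.2 y hy, hb.2 y hy]⟩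
  zero_mem' := ⟨(𝒜 1).zero_mem, fun y _ => by simp⟩
  neg_mem' := fun ha => ⟨(𝒜 1).neg_mem ha.1, fun y hy => by
    rw [neg_mul, mul_neg, ha.2 y hy]⟩
  inv_mem' := fun x hx => ⟨(auxE hG).inv_mem hx.1, fun y hy => by
    have : Commute x y := hx.2 y hy
    exact this.inv_left₀⟩

theorem mem_auxL [Fintype G] {𝒜 : G → AddSubgroup D} (hG : IsFaithfulGrading 𝒜) (x : D) :
    x ∈ auxL hG ↔ x ∈ Lset 𝒜 := Iff.rfl

theorem aux_fin (E : Subfield D) [Module.Finite ↥(Subring.center D) D]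
    (hK : ∀ c ∈ Subring.center D, c ∈ E) : Module.Finite (Subring.center E) E := by
  let W : Submodule (Subring.center D) D :=
    { carrier := E
      add_mem' := fun ha hb => E.add_mem ha hb
      zero_mem' := E.zero_mem
      smul_mem' := fun c x hx => E.mul_mem (hK c c.2) hx }
  obtain ⟨S, hS, hsp⟩ := Submodule.fg_def.1 (IsNoetherian.noetherian W)
  refine ⟨Submodule.fg_def.2 ⟨Subtype.val ⁻¹' S, hS.preimage Subtype.val_injective.injOn, ?_⟩⟩
  rw [eq_top_iff]
  rintro ⟨x, hx⟩ -
  have hxW : x ∈ Submodule.span (Subring.center D) S := by rw [hsp]; exact hx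
  have key : ∀ x ∈ Submodule.span (Subring.center D) S, ∃ hx : x ∈ E,
      (⟨x, hx⟩ : E) ∈ Submodule.span (Subring.center E) (Subtype.val ⁻¹' S : Set E) := by
    intro x hx
    induction hx using Submodule.span_induction with
    | mem x h =>
      have : x ∈ W := hsp ▸ Submodule.subset_span h
      exact ⟨this, Submodule.subset_span h⟩
    | zero => exact ⟨E.zero_mem, Submodule.zero_mem _⟩
    | add x y _ _ hx hy =>
      obtain ⟨hx, hx'⟩ := hx
      obtain ⟨hy, hy'⟩ := hy
      exact ⟨E.add_mem hx hy, Submodule.add_mem _ hx' hy'⟩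
    | smul c x _ hx =>
      obtain ⟨hx, hx'⟩ := hx
      refine ⟨E.mul_mem (hK c c.2) hx, ?_⟩
      have hc : (⟨c, hK c c.2⟩ : E) ∈ Subring.center E := by
        rw [Subring.mem_center_iff]
        intro y
        exact Subtype.ext (Subring.mem_center_iff.1 c.2 y)
      exact Submodule.smul_mem _ (⟨⟨c, hK c c.2⟩, hc⟩ : Subring.center E) hx'
  exact (key x hxW).2

theorem aux_lift [Fintype G] {𝒜 : G → AddSubgroup D} (hG : IsFaithfulGrading 𝒜)
    [Module.Finite ↥(Subring.center D) D]
    (hKe : (Subring.center D : Set D) ⊆ 𝒜 1) {h : G} (hh : h ∈ Hset 𝒜) :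
    ∃ v ∈ 𝒜 h, v ≠ 0 ∧ ∀ y ∈ 𝒜 1, v * y = y * v := by
  obtain ⟨⟨u, hu⟩, hu1⟩ := AddSubgroup.ne_bot_iff_exists_ne_zero.1 (hG.faithful h)
  have hu0 : u ≠ 0 := fun h => hu1 (Subtype.ext h)
  have := aux_fin (auxE hG) hKe
  have hσ : ∀ x ∈ 𝒜 1, u * x * u⁻¹ ∈ 𝒜 1 := by
    intro x hx
    have := hG.mul_mem (hG.mul_mem hu hx) (aux_inv hG hu)
    rwa [mul_one, mul_inv_cancel] at this
  obtain ⟨d, hd0, hd⟩ := aux_SN (E := auxE hG) (fun x => ⟨u * x * u⁻¹, hσ x x.2⟩)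
    (Subtype.ext (by simp [hu0]))
    (fun x y => Subtype.ext (by simp [mul_add, add_mul]))
    (fun x y => Subtype.ext (by simp [mul_assoc, hu0]))
    (fun c hc => Subtype.ext (by
      have : u * (c : D) = c * u := hh u hu c ⟨c.2, fun y hy => by
        have := Subring.mem_center_iff.1 hc ⟨y, hy⟩
        exact (congrArg Subtype.val this).symm⟩
      simp [this, mul_assoc, hu0]))
  have hd0' : (d : D) ≠ 0 := fun h => hd0 (Subtype.ext h)
  refine ⟨(d : D)⁻¹ * u, ?_, mul_ne_zero (inv_ne_zero hd0') hu0, ?_⟩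
  · have := hG.mul_mem ((auxE hG).inv_mem d.2) hu
    rwa [one_mul] at this
  · intro y hy
    have h1 : (d : D) * y = u * y * u⁻¹ * d := congrArg Subtype.val (hd ⟨y, hy⟩)
    rw [mul_assoc, inv_mul_eq_iff_eq_mul₀ hd0', ← mul_assoc, ← mul_assoc, h1]
    simp [mul_assoc, hu0, hd0']

theorem aux_centL [Fintype G] {𝒜 : G → AddSubgroup D} (hG : IsFaithfulGrading 𝒜)
    [Module.Finite ↥(Subring.center D) D]
    (hKe : (Subring.center D : Set D) ⊆ 𝒜 1) (z : D) (hz1 : ∀ y ∈ 𝒜 1, z * y = y * z)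
    (hz : ∀ h ∈ Hset 𝒜, ∀ v ∈ 𝒜 h, (∀ y ∈ 𝒜 1, v * y = y * v) → z * v = v * z) :
    z ∈ 𝒜 1 := by
  have hL : ∀ c ∈ Subring.center D, c ∈ auxL hG := fun c hc =>
    ⟨hKe hc, fun y _ => (Subring.mem_center_iff.1 hc y).symm⟩
  refine (aux_DC (auxL hG) hL z ?_ : z ∈ auxL hG).1
  intro y hy
  obtain ⟨c, hc, rfl⟩ := aux_dec hG y
  rw [Finset.mul_sum, Finset.sum_mul]
  refine Finset.sum_congr rfl fun s _ => ?_
  have hcl : ∀ l ∈ Lset 𝒜, c s * l = l * c s := by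
    intro l hl
    refine aux_uniq' hG (fun s => c s * l) (fun s => l * c s) ?_ ?_ ?_ s
    · intro g
      have := hG.mul_mem (hc g) hl.1
      rwa [mul_one] at this
    · intro g
      have := hG.mul_mem hl.1 (hc g)
      rwa [one_mul] at this
    · rw [← Finset.sum_mul, ← Finset.mul_sum]
      exact hy l hl
  by_cases h0 : c s = 0
  · simp [h0]
  have hsH : s ∈ Hset 𝒜 := by
    intro x hx l hl
    have hx1 : x * (c s)⁻¹ ∈ 𝒜 1 := by
      have := hG.mul_mem hx (aux_inv hG (hc s))
      rwa [mul_inv_cancel] at this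
    have hx2 : x = x * (c s)⁻¹ * c s := by simp [h0]
    rw [hx2, mul_assoc, hcl l hl, ← mul_assoc, ← hl.2 _ hx1, mul_assoc]
  obtain ⟨v, hv, hv0, hvc⟩ := aux_lift hG hKe hsH
  have hx1 : c s * v⁻¹ ∈ 𝒜 1 := by
    have := hG.mul_mem (hc s) (aux_inv hG hv)
    rwa [mul_inv_cancel] at this
  have hx2 : c s = c s * v⁻¹ * v := by simp [hv0]
  rw [hx2, ← mul_assoc, hz1 _ hx1, mul_assoc, hz s hsH v hv hvc, ← mul_assoc]

theorem aux_root [Module.Finite ↥(Subring.center D) D] (ζ : D) (hζK : ζ ∈ Subring.center D)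
    (he : 0 < orderOf ζ) (d : D) (hd : d ^ orderOf ζ = 1) : ∃ k : ℕ, d = ζ ^ k := by
  set e := orderOf ζ with hedef
  let z : Subring.center D := ⟨ζ, hζK⟩
  have hz : IsPrimitiveRoot z e := by
    have : orderOf z = e := by
      rw [hedef]
      exact (orderOf_injective (Subring.center D).subtype.toMonoidHom Subtype.val_injective z).symm
    rw [← this]
    exact IsPrimitiveRoot.orderOf z
  have hint : IsIntegral (Subring.center D) d := Algebra.IsIntegral.isIntegral d
  have hdvd : minpoly (Subring.center D) d ∣ Polynomial.X ^ e - 1 := by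
    apply minpoly.dvd
    simp [hd]
  rw [Polynomial.X_pow_sub_one_eq_prod he hz] at hdvd
  obtain ⟨w, hw, hw2⟩ := (minpoly.prime hint).exists_mem_finset_dvd hdvd
  have hw1 : w ^ e = 1 := by
    rw [Polynomial.mem_nthRootsFinset he] at hw; exact hw
  have : NeZero e := ⟨he.ne'⟩
  obtain ⟨k, -, hk⟩ := hz.eq_pow_of_pow_eq_one hw1
  refine ⟨k, ?_⟩
  have h3 := Polynomial.aeval_eq_zero_of_dvd_aeval_eq_zero hw2 (minpoly.aeval _ d)
  rw [map_sub, Polynomial.aeval_X, Polynomial.aeval_C, sub_eq_zero] at h3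
  rw [h3, ← hk]
  rfl

theorem AuxData.form {D : Type*} [DivisionRing D] {H : Type*} [Group H]
    {Γ : Subgroup Dˣ} {π : Γ →* H} {ζ : D} {e : ℕ} [CharZero D] [Finite H]
    (A : AuxData Γ π ζ e) (hnd : ∀ w : Γ, (∀ y : Γ, w * y = y * w) → π w = 1) :
    ∃ (A : Type) (_ : CommGroup A) (_ : Finite A), Nonempty (H ≃* A × A) := by
  have hcomm := A.comm
  let _ : CommGroup H := { (inferInstance : Group H) with mul_comm := hcomm }
  have hcD : ∀ (x y : Γ) (d : D), (((⁅x, y⁆ : Γ) : Dˣ) : D) * d = d * (((⁅x, y⁆ : Γ) : Dˣ) : D) := by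
    intro x y
    apply A.root_cen
    have h1 := congrArg (fun z : Γ => ((z : Dˣ) : D)) (A.comm_root (hcomm (π x) (π y)))
    simpa using h1
  have hcΓ : ∀ x y z : Γ, ⁅x, y⁆ * z = z * ⁅x, y⁆ := by
    intro x y z
    apply Subtype.ext
    apply Units.ext
    exact hcD x y _
  have hbl : ∀ x y z : Γ, ⁅x * y, z⁆ = ⁅x, z⁆ * ⁅y, z⁆ := by
    intro x y z
    have : ⁅x * y, z⁆ = x * ⁅y, z⁆ * x⁻¹ * ⁅x, z⁆ := by
      simp only [commutatorElement_def]; group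
    rw [this, ← hcΓ y z x, mul_inv_cancel_right, hcΓ]
  have hbr : ∀ x y z : Γ, ⁅x, y * z⁆ = ⁅x, y⁆ * ⁅x, z⁆ := by
    intro x y z
    have : ⁅x, y * z⁆ = ⁅x, y⁆ * (y * ⁅x, z⁆ * y⁻¹) := by
      simp only [commutatorElement_def]; group
    rw [this, ← hcΓ x z y, mul_inv_cancel_right]
  have hk1 : ∀ x z : Γ, π z = 1 → ⁅z, x⁆ = 1 := fun x z hz =>
    commutatorElement_eq_one_iff_mul_comm.2 (A.ker z hz x)
  have hk2 : ∀ x z : Γ, π z = 1 → ⁅x, z⁆ = 1 := fun x z hz =>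
    commutatorElement_eq_one_iff_mul_comm.2 (A.ker z hz x).symm
  obtain ⟨s, hs⟩ := A.surj.hasRightInverse
  have hwd : ∀ x x' y y' : Γ, π x = π x' → π y = π y' → ⁅x, y⁆ = ⁅x', y'⁆ := by
    intro x x' y y' hx hy
    have e1 : x = (x * x'⁻¹) * x' := by group
    have e2 : y = (y * y'⁻¹) * y' := by group
    rw [e1, hbl, hk1 y _ (by rw [map_mul, map_inv, hx, mul_inv_cancel]), one_mul, e2, hbr,
      hk2 x' _ (by rw [map_mul, map_inv, hy, mul_inv_cancel]), one_mul]
  let c : Γ → Γ → (Subring.center D)ˣ := fun x y => Units.mk0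
    ⟨(((⁅x, y⁆ : Γ) : Dˣ) : D), Subring.mem_center_iff.2 fun d => (hcD x y d).symm⟩
    (fun h => Units.ne_zero ((⁅x, y⁆ : Γ) : Dˣ) (congrArg Subtype.val h))
  have hc : ∀ x y, ((c x y : Subring.center D) : D) = (((⁅x, y⁆ : Γ) : Dˣ) : D) := fun x y => rfl
  have hcext : ∀ u v : (Subring.center D)ˣ, ((u : Subring.center D) : D) = v → u = v :=
    fun u v h => Units.ext (Subtype.ext h)
  let β : H →* H →* (Subring.center D)ˣ := MonoidHom.mk'
    (fun g => MonoidHom.mk' (fun h => c (s g) (s h)) (by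
      intro a b
      apply hcext
      have : ⁅s g, s (a * b)⁆ = ⁅s g, s a⁆ * ⁅s g, s b⁆ := by
        rw [← hbr]
        apply hwd _ _ _ _ rfl
        rw [map_mul, hs, hs, hs]
      rw [hc, this]
      rfl)) (by
      intro a b
      ext k
      have : ⁅s (a * b), s k⁆ = ⁅s a, s k⁆ * ⁅s b, s k⁆ := by
        rw [← hbl]
        refine hwd _ _ _ _ ?_ rfl
        rw [map_mul, hs, hs, hs]
      change (((⁅s (a * b), s k⁆ : Γ) : Dˣ) : D) = _
      rw [this]
      rfl)
  have hβ : ∀ g h, β g h = c (s g) (s h) := fun g h => rfl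
  refine aux_symp (F := Subring.center D) (Nat.card H) H rfl β ?_ ?_
  · intro x
    apply hcext
    rw [hβ, hc, commutatorElement_self]
    rfl
  · intro x hx
    rw [← hs x]
    apply hnd
    intro y
    rw [← commutatorElement_eq_one_iff_mul_comm, hwd (s x) (s x) y (s (π y)) rfl (hs _).symm]
    apply Subtype.ext
    apply Units.ext
    rw [← hc, ← hβ, hx]
    rfl

theorem aux_data [Fintype G] {𝒜 : G → AddSubgroup D} (hG : IsFaithfulGrading 𝒜)
    [Module.Finite ↥(Subring.center D) D]
    (hKe : (Subring.center D : Set D) ⊆ 𝒜 1) (ζ : D) (hζK : ζ ∈ Subring.center D)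
    (hζ : orderOf ζ = Monoid.exponent G)
    (H : Subgroup G) (hHcar : (H : Set G) = Hset 𝒜) :
    ∃ (Γ : Subgroup Dˣ) (π : Γ →* H), AuxData Γ π ζ (Monoid.exponent G) ∧
      (∀ w : Γ, (∀ y : Γ, w * y = y * w) → π w = 1) := by
  have he0 : 0 < Monoid.exponent G := Monoid.exponent_pos.2 Monoid.ExponentExists.of_finite
  have hH : ∀ g, g ∈ H ↔ g ∈ Hset 𝒜 := fun g => by rw [← hHcar]; rfl
  let Γ : Subgroup Dˣ :=
    { carrier := {u | ∃ h : H, (u : D) ∈ 𝒜 h ∧ ∀ y ∈ 𝒜 1, (u : D) * y = y * u}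
      mul_mem' := by
        rintro a b ⟨g, hg, hg2⟩ ⟨h, hh, hh2⟩
        refine ⟨g * h, hG.mul_mem hg hh, fun y hy => ?_⟩
        rw [Units.val_mul, mul_assoc, hh2 y hy, ← mul_assoc, hg2 y hy, mul_assoc]
      one_mem' := ⟨1, hG.one_mem, fun y _ => by simp⟩
      inv_mem' := by
        rintro a ⟨g, hg, hg2⟩
        refine ⟨g⁻¹, ?_, fun y hy => ?_⟩
        · have := aux_inv hG hg
          rwa [← Units.val_inv_eq_inv_val] at this
        · have : Commute (a : D) y := hg2 y hy
          rw [Units.val_inv_eq_inv_val]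
          exact this.inv_left₀ }
  have hΓ : ∀ u : Γ, ∃ h : H, ((u : Dˣ) : D) ∈ 𝒜 h ∧ ∀ y ∈ 𝒜 1, ((u : Dˣ) : D) * y = y * (u : Dˣ) :=
    fun u => u.2
  choose deg hdeg hcom using hΓ
  have huniq : ∀ (u : Γ) (h : H), ((u : Dˣ) : D) ∈ 𝒜 h → deg u = h := fun u h hu =>
    Subtype.ext (aux_deg hG (Units.ne_zero _) (hdeg u) hu)
  let π : Γ →* H := MonoidHom.mk' deg (fun a b => huniq _ _ (hG.mul_mem (hdeg a) (hdeg b)))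
  have hπ : ∀ u, π u = deg u := fun u => rfl
  have hsurj : ∀ h ∈ Hset 𝒜, ∀ v ∈ 𝒜 h, v ≠ 0 → (∀ y ∈ 𝒜 1, v * y = y * v) →
      ∃ u : Γ, ((u : Dˣ) : D) = v := fun h hh v hv hv0 hvc =>
    ⟨⟨Units.mk0 v hv0, ⟨h, (hH h).2 hh⟩, hv, hvc⟩, rfl⟩
  refine ⟨Γ, π, ⟨?_, ?_, ?_, ?_, ?_, ?_⟩, ?_⟩
  · exact fun d => (Subring.mem_center_iff.1 hζK d).symm
  · intro d hd
    rw [← hζ] at hd he0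
    exact aux_root ζ hζK he0 d hd
  · intro h
    apply Subtype.ext
    exact Monoid.pow_exponent_eq_one (h : G)
  · intro z hz y
    apply Subtype.ext
    apply Units.ext
    have hz1 : ((z : Dˣ) : D) ∈ 𝒜 1 := by
      have := hdeg z
      rw [← hπ, hz] at this
      exact this
    exact (hcom y _ hz1).symm
  · intro w hw
    apply huniq
    exact hKe (Subring.mem_center_iff.2 fun d => (hw d).symm)
  · rintro ⟨h, hh⟩
    obtain ⟨v, hv, hv0, hvc⟩ := aux_lift hG hKe ((hH h).1 hh)
    obtain ⟨u, hu⟩ := hsurj h ((hH h).1 hh) v hv hv0 hvc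
    refine ⟨u, huniq _ _ ?_⟩
    rw [hu]; exact hv
  · intro w hw
    apply huniq
    refine aux_centL hG hKe _ (hcom w) ?_
    intro h hh v hv hvc
    by_cases hv0 : v = 0
    · simp [hv0]
    obtain ⟨u, rfl⟩ := hsurj h hh v hv hv0 hvc
    exact congrArg (fun z : Γ => ((z : Dˣ) : D)) (hw u)

/-- Under the standing hypotheses with the center `K` contained in
`D_e` (and `K` containing a primitive `n_G`-th root of unity), the subgroup `H` (the
kernel of the conjugation action of `G` on `L`) is abelian, and there is a finite
abelian group `A` with `H ≅ A × A`. -/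
theorem Hsubgroup_abelian_and_product_form
    [Finite G] [CharZero D]
    (𝒜 : G → AddSubgroup D) (hG : IsFaithfulGrading 𝒜)
    [Module.Finite ↥(Subring.center D) D]
    (hKe : (Subring.center D : Set D) ⊆ 𝒜 1)
    (ζ : D) (hζK : ζ ∈ Subring.center D)
    (hζ : orderOf ζ = Monoid.exponent G)
    (H : Subgroup G) (hHcar : (H : Set G) = Hset 𝒜) (hHn : H.Normal) :
    (∀ a ∈ H, ∀ b ∈ H, a * b = b * a) ∧
      ∃ (A : Type) (_ : CommGroup A) (_ : Finite A), Nonempty (↥H ≃* A × A) := by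
  classical
  have := Fintype.ofFinite G
  obtain ⟨Γ, π, A, hnd⟩ := aux_data hG hKe ζ hζK hζ H hHcar
  refine ⟨fun a ha b hb => ?_, A.form hnd⟩
  exact congrArg Subtype.val (A.comm ⟨a, ha⟩ ⟨b, hb⟩)
end
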